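/- arXiv:1910.14245 — 2 statements merged into one kernel-verified Lean document; each statement's English description precedes it below -/
import Mathlib

section
/- There exist constants c₅ ∈ (0,1) and C > 0, independent of ν, n, l, λ, such that for all nonzero integers n, l, all λ ∈ ℂ with l·Im λ ≤ c₅·|νnl|^{1/2}, all ν with 0 < ν < c₅·min(|l|,1), and every smooth U : [0,1] → ℂ with U(0) = 0 and U(1) = 1 satisfying −ν·Δ̂₁U + i·l·(λ−r²)·U = 0 on (0,1), one has for every s ∈ (0,1]: ∫₀^s |U(r)|² r dr ≤ C·s·|U(s)|² / A(s), where A(s) = |l(λ−s²)/ν|^{1/2} + |ls/ν|^{1/3} + |l| + |n/s|. -/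
open MeasureTheory

/-- The operator `Δ̂₁ f = f'' + f'/r − (n²/r² + l²) f − (2rl²/(n²+r²l²)) f'`. -/
noncomputable def hatD1 (n l : ℤ) (f : ℝ → ℂ) (r : ℝ) : ℂ :=
  deriv (deriv f) r + deriv f r / (r : ℂ)
    - ((n : ℂ) ^ 2 / (r : ℂ) ^ 2 + (l : ℂ) ^ 2) * f r
    - (2 * (r : ℂ) * (l : ℂ) ^ 2 / ((n : ℂ) ^ 2 + (r : ℂ) ^ 2 * (l : ℂ) ^ 2)) * deriv f r


lemma mono_aux {F F' : ℝ → ℝ} {a b : ℝ} (hab : a ≤ b) (hc : ContinuousOn F (Set.Icc a b))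
    (hd : ∀ x ∈ Set.Ioo a b, HasDerivAt F (F' x) x) (h0 : ∀ x ∈ Set.Ioo a b, 0 ≤ F' x) :
    F a ≤ F b := by
  have hm : MonotoneOn F (Set.Icc a b) := by
    apply monotoneOn_of_deriv_nonneg (convex_Icc a b) hc
    · intro x hx
      rw [interior_Icc] at hx
      exact (hd x hx).differentiableAt.differentiableWithinAt
    · intro x hx
      rw [interior_Icc] at hx
      rw [(hd x hx).deriv]
      exact h0 x hx
  exact hm (Set.left_mem_Icc.2 hab) (Set.right_mem_Icc.2 hab) hab

lemma slope_le {F F' : ℝ → ℝ} {a b B : ℝ} (hab : a ≤ b) (hc : ContinuousOn F (Set.Icc a b))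
    (hd : ∀ x ∈ Set.Ioo a b, HasDerivAt F (F' x) x) (h0 : ∀ x ∈ Set.Ioo a b, F' x ≤ B) :
    F b - F a ≤ B * (b - a) := by
  have := mono_aux (F := fun x => B * x - F x) (F' := fun x => B * 1 - F' x) hab
    ((continuousOn_const.mul continuousOn_id).sub hc)
    (fun x hx => ((hasDerivAt_id x).const_mul B).sub (hd x hx))
    (fun x hx => by have := h0 x hx; linarith)
  linarith

lemma G0 {M f j g : ℝ → ℝ} {a b w F Y T : ℝ} (hab : a ≤ b) (hw : 0 < w) (hT : 0 < T)
    (hY : 0 ≤ Y)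
    (Mc : ContinuousOn M (Set.Icc a b)) (dM : ∀ x ∈ Set.Ioo a b, HasDerivAt M (f x) x)
    (f0 : ∀ x ∈ Set.Ioo a b, 0 ≤ f x) (fF : ∀ x ∈ Set.Ioo a b, f x ≤ F) (hF : 0 ≤ F)
    (dj : ∀ x ∈ Set.Ioo a b, HasDerivAt j (g x) x)
    (sg : (∀ x ∈ Set.Ioo a b, T * f x ≤ g x) ∨ (∀ x ∈ Set.Ioo a b, T * f x ≤ - g x))
    (good : ∀ x, a ≤ x → x + w ≤ b → ∃ t ∈ Set.Ioo x (x + w), |j t| ≤ Y) :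
    M b - M a ≤ 2 * w * F + 2 * Y / T := by
  have hYT : 0 ≤ 2 * Y / T := by positivity
  by_cases hl : b - a < 2 * w
  · have h1 := slope_le hab Mc dM fF
    nlinarith
  · push Not at hl
    obtain ⟨t1, ⟨h1a, h1b⟩, h1⟩ := good a le_rfl (by linarith)
    obtain ⟨t2, ⟨h2a, h2b⟩, h2⟩ := good (b - w) (by linarith) (by linarith)
    have h12 : t1 ≤ t2 := by linarith
    have hsub : ∀ x ∈ Set.Ioo t1 t2, x ∈ Set.Ioo a b := fun x hx => ⟨by linarith [hx.1], by linarith [hx.2]⟩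
    have e1 := slope_le (F := M) (F' := f) (a := a) (b := t1) (B := F) h1a.le
      (Mc.mono (Set.Icc_subset_Icc le_rfl (by linarith)))
      (fun x hx => dM x ⟨hx.1, by linarith [hx.2]⟩) (fun x hx => fF x ⟨hx.1, by linarith [hx.2]⟩)
    have e2 := slope_le (F := M) (F' := f) (a := t2) (b := b) (B := F) (by linarith)
      (Mc.mono (Set.Icc_subset_Icc (by linarith) le_rfl))
      (fun x hx => dM x ⟨by linarith [hx.1], hx.2⟩) (fun x hx => fF x ⟨by linarith [hx.1], hx.2⟩)
    have jc : ContinuousOn j (Set.Icc t1 t2) := fun x hx =>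
      (dj x ⟨by linarith [hx.1], by linarith [hx.2]⟩).continuousAt.continuousWithinAt
    have Mc' : ContinuousOn M (Set.Icc t1 t2) :=
      Mc.mono (Set.Icc_subset_Icc (by linarith) (by linarith))
    have e3 : T * (M t2 - M t1) ≤ 2 * Y := by
      rw [abs_le] at h1 h2
      rcases sg with sg | sg
      · have := mono_aux (F := fun x => j x - T * M x) (F' := fun x => g x - T * f x) h12
          (jc.sub (continuousOn_const.mul Mc'))
          (fun x hx => (dj x (hsub x hx)).sub ((dM x (hsub x hx)).const_mul T))
          (fun x hx => by have := sg x (hsub x hx); linarith)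
        linarith
      · have := mono_aux (F := fun x => - j x - T * M x) (F' := fun x => - g x - T * f x) h12
          (jc.neg.sub (continuousOn_const.mul Mc'))
          (fun x hx => (dj x (hsub x hx)).neg.sub ((dM x (hsub x hx)).const_mul T))
          (fun x hx => by have := sg x (hsub x hx); linarith)
        linarith
    have e4 : M t2 - M t1 ≤ 2 * Y / T := by
      rw [le_div_iff₀ hT]; linarith
    nlinarith

/-- splitting around the critical layer -/
lemma split_layer {M : ℝ → ℝ} {κ μ δ A B T B1 F : ℝ} (hκ : 0 < κ) (hA : 0 < A) (hAB : A ≤ B)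
    (hδ : 0 < δ) (hT : T ≤ κ * δ * A) (hF : 0 ≤ F)
    (hM : ∀ a b, A ≤ a → a ≤ b → b ≤ B → M b - M a ≤ F * (b - a))
    (h : ∀ a b, A ≤ a → a ≤ b → b ≤ B →
      ((∀ x ∈ Set.Ioo a b, T ≤ κ * (μ - x ^ 2)) ∨ (∀ x ∈ Set.Ioo a b, T ≤ - (κ * (μ - x ^ 2)))) →
      M b - M a ≤ B1) :
    M B - M A ≤ 2 * B1 + 2 * δ * F := by
  set c := Real.sqrt (max μ 0) with hc
  have c0 : 0 ≤ c := Real.sqrt_nonneg _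
  have c2 : c ^ 2 = max μ 0 := Real.sq_sqrt (le_max_right _ _)
  set a1 := max A (min B (c - δ)) with ha1
  set a2 := max A (min B (c + δ)) with ha2
  have a1A : A ≤ a1 := le_max_left _ _
  have a2B : a2 ≤ B := max_le hAB (min_le_left _ _)
  have a12 : a1 ≤ a2 := max_le_max le_rfl (min_le_min le_rfl (by linarith))
  have hlen : a2 - a1 ≤ 2 * δ := by
    have : a2 ≤ a1 + 2 * δ := by
      apply max_le
      · linarith
      · have : min B (c + δ) ≤ min B (c - δ) + 2 * δ := by
          rcases le_total B (c - δ) with h | h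
          · rw [min_eq_left h]; linarith [min_le_left B (c + δ)]
          · rw [min_eq_right h]; linarith [min_le_right B (c + δ)]
        linarith [le_max_right A (min B (c - δ))]
    linarith
  have e1 : M a1 - M A ≤ B1 := by
    apply h A a1 le_rfl a1A (a12.trans a2B)
    left
    intro x hx
    have hx1 : x < c - δ := by
      rcases max_choice A (min B (c - δ)) with h | h
      · exfalso; rw [ha1, h] at hx; linarith [hx.1, hx.2]
      · have := hx.2; rw [ha1, h] at this; exact this.trans_le (min_le_right _ _)
    have hμ : c ^ 2 = μ := by
      rw [c2]; apply max_eq_left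
      by_contra hneg
      push Not at hneg
      have : c = 0 := by rw [hc, max_eq_right hneg.le, Real.sqrt_zero]
      linarith [hx.1]
    have : δ * A ≤ μ - x ^ 2 := by rw [← hμ]; nlinarith [hx.1]
    nlinarith
  have e3 : M B - M a2 ≤ B1 := by
    apply h a2 B (a1A.trans a12) a2B le_rfl
    right
    intro x hx
    have hx1 : c + δ < x := by
      by_contra hcon
      push Not at hcon
      have : min B (c + δ) < x := (le_max_right _ _).trans_lt hx.1
      rcases min_lt_iff.1 this with h | h
      · linarith [hx.2]
      · linarith
    have hxA : A < x := (le_max_left _ _).trans_lt hx.1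
    have hμ : μ ≤ c ^ 2 := by rw [c2]; exact le_max_left _ _
    have : δ * A ≤ x ^ 2 - μ := by nlinarith
    nlinarith
  have e2 := hM a1 a2 a1A a12 a2B
  nlinarith

noncomputable def pw (n L r : ℝ) : ℝ := r / (n ^ 2 + r ^ 2 * L)

structure Sys (n L κ μ β : ℝ) (h w k j M E : ℝ → ℝ) : Prop where
  hn : 1 ≤ n
  hL : 0 ≤ L
  hκ : 0 < κ
  h0 : ∀ r, 0 ≤ h r
  w0 : ∀ r, 0 ≤ w r
  hc : ContinuousOn h (Set.Icc 0 1)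
  Mc : ContinuousOn M (Set.Icc 0 1)
  Ec : ContinuousOn E (Set.Icc 0 1)
  M0 : M 0 = 0
  E0 : E 0 = 0
  hz : h 0 = 0
  hk : ∀ r ∈ Set.Ioo (0:ℝ) 1, k r = E r - β * M r
  dM : ∀ r ∈ Set.Ioo (0:ℝ) 1, HasDerivAt M (pw n L r * h r) r
  dE : ∀ r ∈ Set.Ioo (0:ℝ) 1, HasDerivAt E (pw n L r * w r + h r / r) r
  dh : ∀ r ∈ Set.Ioo (0:ℝ) 1, HasDerivAt h (2 * k r / pw n L r) r
  dj : ∀ r ∈ Set.Ioo (0:ℝ) 1, HasDerivAt j (κ * (μ - r ^ 2) * (pw n L r * h r)) r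
  hj : ∀ r ∈ Set.Ioo (0:ℝ) 1, (j r) ^ 2 ≤ (pw n L r) ^ 2 * (w r * h r)
  hkk : ∀ r ∈ Set.Ioo (0:ℝ) 1, (k r) ^ 2 ≤ (pw n L r) ^ 2 * (w r * h r)

namespace Sys
variable {n L κ μ β : ℝ} {h w k j M E : ℝ → ℝ}

lemma den_pos (S : Sys n L κ μ β h w k j M E) (r : ℝ) : 0 < n ^ 2 + r ^ 2 * L := by
  have := S.hn; have := S.hL; positivity

lemma p_pos (S : Sys n L κ μ β h w k j M E) {r : ℝ} (hr : 0 < r) : 0 < pw n L r :=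
  div_pos hr (S.den_pos r)

lemma p_id (S : Sys n L κ μ β h w k j M E) {r : ℝ} (hr : 0 < r) :
    pw n L r * (n ^ 2 / r ^ 2 + L) = 1 / r := by
  have := S.den_pos r
  unfold pw
  field_simp

lemma p_lower (S : Sys n L κ μ β h w k j M E) {r s : ℝ} (hr : 0 < r) (hrs : r ≤ s) :
    pw n L s * r ≤ s * pw n L r := by
  unfold pw
  have h1 := S.den_pos r
  have h2 := S.den_pos s
  have hs : 0 < s := by linarith
  have : r / (n ^ 2 + s ^ 2 * L) ≤ r / (n ^ 2 + r ^ 2 * L) := by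
    apply div_le_div_of_nonneg_left hr.le h1
    have := S.hL
    gcongr
  calc s / (n ^ 2 + s ^ 2 * L) * r = s * (r / (n ^ 2 + s ^ 2 * L)) := by ring
    _ ≤ _ := by gcongr

lemma p_upper (S : Sys n L κ μ β h w k j M E) {r s : ℝ} (hr : 0 < r) (hrs : r ≤ s)
    (hs2 : s / 2 ≤ r) : pw n L r ≤ 2 * pw n L s := by
  unfold pw
  have h1 := S.den_pos r
  have h2 := S.den_pos s
  have hs : 0 < s := by linarith
  rw [div_le_iff₀ h1, mul_div_assoc', div_mul_eq_mul_div, le_div_iff₀ h2]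
  have hL := S.hL
  have hn : 0 ≤ n ^ 2 := sq_nonneg n
  have : r * s ^ 2 * L ≤ 2 * s * r ^ 2 * L := by
    have : r * s * s ≤ r * s * (2 * r) := by gcongr; linarith
    nlinarith
  nlinarith

lemma e_bound {p a b t θ : ℝ} (hp : 0 ≤ p) (ha : 0 ≤ a) (hb : 0 ≤ b) (hθ : 0 < θ)
    (ht : t ^ 2 ≤ p ^ 2 * (a * b)) : |t| ≤ (θ * (p * b) + p * a / θ) / 2 := by
  apply abs_le_of_sq_le_sq _ (by positivity)
  have : ((θ * (p * b) + p * a / θ) / 2) ^ 2 - p ^ 2 * (a * b)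
      = ((θ * (p * b) - p * a / θ) / 2) ^ 2 := by
    field_simp; ring
  nlinarith [sq_nonneg ((θ * (p * b) - p * a / θ) / 2)]

lemma j_bound (S : Sys n L κ μ β h w k j M E) {r θ : ℝ} (hr : r ∈ Set.Ioo (0:ℝ) 1) (hθ : 0 < θ) :
    |j r| ≤ (θ * (pw n L r * h r) + (pw n L r * w r + h r / r) / θ) / 2 := by
  have h1 := e_bound (S.p_pos hr.1).le (S.w0 r) (S.h0 r) hθ (S.hj r hr)
  have : 0 ≤ h r / r := div_nonneg (S.h0 r) hr.1.le
  have : pw n L r * w r / θ ≤ (pw n L r * w r + h r / r) / θ := by gcongr; linarith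
  linarith

lemma k_bound (S : Sys n L κ μ β h w k j M E) {r θ : ℝ} (hr : r ∈ Set.Ioo (0:ℝ) 1) (hθ : 0 < θ) :
    |k r| ≤ (θ * (pw n L r * h r) + (pw n L r * w r) / θ) / 2 :=
  e_bound (S.p_pos hr.1).le (S.w0 r) (S.h0 r) hθ (S.hkk r hr)

lemma M_mono (S : Sys n L κ μ β h w k j M E) {a b : ℝ} (ha : 0 ≤ a) (hab : a ≤ b) (hb : b ≤ 1) :
    M a ≤ M b :=
  mono_aux hab (S.Mc.mono (Set.Icc_subset_Icc ha hb))
    (fun x hx => S.dM x ⟨by linarith [hx.1], by linarith [hx.2]⟩)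
    (fun x hx => mul_nonneg (S.p_pos (by linarith [hx.1])).le (S.h0 x))

lemma E_mono (S : Sys n L κ μ β h w k j M E) {a b : ℝ} (ha : 0 ≤ a) (hab : a ≤ b) (hb : b ≤ 1) :
    E a ≤ E b :=
  mono_aux hab (S.Ec.mono (Set.Icc_subset_Icc ha hb))
    (fun x hx => S.dE x ⟨by linarith [hx.1], by linarith [hx.2]⟩)
    (fun x hx => by
      have hx0 : 0 < x := by linarith [hx.1]
      exact add_nonneg (mul_nonneg (S.p_pos hx0).le (S.w0 x)) (div_nonneg (S.h0 x) hx0.le))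

lemma M_nonneg (S : Sys n L κ μ β h w k j M E) {a : ℝ} (ha : 0 ≤ a) (h1 : a ≤ 1) : 0 ≤ M a := by
  rw [← S.M0]; exact S.M_mono le_rfl ha h1

lemma E_nonneg (S : Sys n L κ μ β h w k j M E) {a : ℝ} (ha : 0 ≤ a) (h1 : a ≤ 1) : 0 ≤ E a := by
  rw [← S.E0]; exact S.E_mono le_rfl ha h1

/-- `Q M ≤ E` for `Q ≤ n²/s² + L`. -/
lemma QM (S : Sys n L κ μ β h w k j M E) {s Q : ℝ} (hs : 0 < s) (hs1 : s ≤ 1)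
    (hQ : Q ≤ n ^ 2 / s ^ 2 + L) : Q * M s ≤ E s := by
  have := mono_aux (F := fun x => E x - Q * M x)
    (F' := fun x => (pw n L x * w x + h x / x) - Q * (pw n L x * h x)) hs.le
    ((S.Ec.mono (Set.Icc_subset_Icc le_rfl hs1)).sub
      (continuousOn_const.mul (S.Mc.mono (Set.Icc_subset_Icc le_rfl hs1))))
    (fun x hx => (S.dE x ⟨hx.1, by linarith [hx.2]⟩).sub
      ((S.dM x ⟨hx.1, by linarith [hx.2]⟩).const_mul Q))
    (fun x hx => by
      have hx0 : 0 < x := hx.1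
      have hp := S.p_pos hx0
      have h1 : Q ≤ n ^ 2 / x ^ 2 + L := by
        have : n ^ 2 / s ^ 2 ≤ n ^ 2 / x ^ 2 := by
          have := hx.2
          gcongr
        linarith
      have h2 : h x / x = pw n L x * (n ^ 2 / x ^ 2 + L) * h x := by
        rw [S.p_id hx0]; ring
      have h3 : 0 ≤ pw n L x * w x := mul_nonneg hp.le (S.w0 x)
      have h4 : Q * (pw n L x * h x) ≤ (n ^ 2 / x ^ 2 + L) * (pw n L x * h x) := by
        have := mul_nonneg hp.le (S.h0 x)
        gcongr
      rw [h2]; nlinarith)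
  simp only [S.E0, S.M0] at this
  linarith

lemma dp (S : Sys n L κ μ β h w k j M E) {r : ℝ} (hr : 0 < r) :
    HasDerivAt (pw n L) (pw n L r * (1 / r - 2 * r * L / (n ^ 2 + r ^ 2 * L))) r := by
  have h1 := S.den_pos r
  have := (hasDerivAt_id r).div (((hasDerivAt_pow 2 r).mul_const L).const_add (n ^ 2)) h1.ne'
  refine HasDerivAt.congr_deriv (f := pw n L) this ?_
  unfold pw
  simp only [id]
  field_simp
  ring

lemma p_cont (S : Sys n L κ μ β h w k j M E) : Continuous (pw n L) := by
  unfold pw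
  exact continuous_id.div (by fun_prop) (fun r => (S.den_pos r).ne')

/-- sup bound -/
lemma sup_bound (S : Sys n L κ μ β h w k j M E) {t s θ : ℝ} (ht : 0 < t) (hts : t ≤ s) (hs : s < 1)
    (hθ : 0 < θ) : pw n L t * h t ≤ 3 / 2 * (θ * M s + E s / θ) := by
  have h1 := mono_aux (F := fun x => 3 / 2 * (θ * M x + E x / θ) - pw n L x * h x)
    (F' := fun x => 3 / 2 * (θ * (pw n L x * h x) + (pw n L x * w x + h x / x) / θ)
      - (pw n L x * (1 / x - 2 * x * L / (n ^ 2 + x ^ 2 * L)) * h x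
        + pw n L x * (2 * k x / pw n L x))) ht.le
    (by
      have hsub : Set.Icc 0 t ⊆ Set.Icc (0:ℝ) 1 := Set.Icc_subset_Icc le_rfl (by linarith)
      exact (continuousOn_const.mul ((continuousOn_const.mul (S.Mc.mono hsub)).add
        ((S.Ec.mono hsub).div_const θ))).sub (S.p_cont.continuousOn.mul (S.hc.mono hsub)))
    (fun x hx => by
      have hx' : x ∈ Set.Ioo (0:ℝ) 1 := ⟨hx.1, by linarith [hx.2]⟩
      exact ((((S.dM x hx').const_mul θ).add ((S.dE x hx').div_const θ)).const_mul (3/2)).sub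
        ((S.dp hx.1).mul (S.dh x hx')))
    (fun x hx => by
      have hx' : x ∈ Set.Ioo (0:ℝ) 1 := ⟨hx.1, by linarith [hx.2]⟩
      have hx0 : 0 < x := hx.1
      have hp := S.p_pos hx0
      have hk := (abs_le.1 (S.k_bound hx' hθ)).2
      have hh := S.h0 x
      have e1 : pw n L x * (2 * k x / pw n L x) = 2 * k x := by field_simp
      have e2 : 0 ≤ pw n L x * (2 * x * L / (n ^ 2 + x ^ 2 * L)) * h x := by
        have := S.den_pos x; have := S.hL; positivity
      have e3 : pw n L x * (1 / x) * h x ≤ (θ * (pw n L x * h x) + (h x / x) / θ) / 2 := by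
        have f1 : pw n L x * (1 / x ^ 2) * h x ≤ h x / x := by
          have : pw n L x * (1 / x ^ 2) ≤ 1 / x := by
            rw [← S.p_id hx0]
            have hn : 1 ≤ n ^ 2 := by nlinarith [S.hn]
            have hL := S.hL
            have : 1 / x ^ 2 ≤ n ^ 2 / x ^ 2 := by gcongr
            gcongr
            linarith
          calc _ ≤ 1 / x * h x := by gcongr
            _ = _ := by ring
        have f2 : pw n L x * (1 / x) * h x ≤
            (θ * (pw n L x * h x) + (pw n L x * (1 / x ^ 2) * h x) / θ) / 2 := by
          have : (θ * (pw n L x * h x) + (pw n L x * (1 / x ^ 2) * h x) / θ) / 2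
            - pw n L x * (1 / x) * h x = pw n L x * h x * (θ - 1 / x) ^ 2 / (2 * θ) := by
            field_simp; ring
          have : 0 ≤ pw n L x * h x * (θ - 1 / x) ^ 2 / (2 * θ) := by positivity
          linarith
        have f3 : (pw n L x * (1 / x ^ 2) * h x) / θ ≤ (h x / x) / θ := by gcongr
        linarith
      have e4 : (pw n L x * w x + h x / x) / θ = pw n L x * w x / θ + h x / x / θ := by ring
      have e5 : 0 ≤ pw n L x * w x / θ := by have := S.w0 x; positivity
      have e6 : 0 ≤ h x / x / θ := by positivity
      rw [e1, e4]
      nlinarith)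
  simp only [S.E0, S.M0, S.hz] at h1
  have m1 := S.M_mono ht.le hts hs.le
  have m2 := S.E_mono ht.le hts hs.le
  have : E t / θ ≤ E s / θ := by gcongr
  have : θ * M t ≤ θ * M s := by gcongr
  simp only [mul_zero, zero_div, add_zero, sub_zero] at h1
  linarith

/-- good points -/
lemma good_pt (S : Sys n L κ μ β h w k j M E) {x v θ : ℝ} (hx : 0 < x) (hv : 0 < v) (h1 : x + v ≤ 1)
    (hθ : 0 < θ) : ∃ t ∈ Set.Ioo x (x + v),
      |j t| ≤ (θ * (M (x + v) - M x) + (E (x + v) - E x) / θ) / 2 / v := by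
  have hsub : Set.Icc x (x + v) ⊆ Set.Icc (0:ℝ) 1 := Set.Icc_subset_Icc hx.le h1
  obtain ⟨t, ht, he⟩ := exists_hasDerivAt_eq_slope (fun y => (θ * M y + E y / θ) / 2)
    (fun y => (θ * (pw n L y * h y) + (pw n L y * w y + h y / y) / θ) / 2)
    (show x < x + v by linarith)
    ((((continuousOn_const.mul (S.Mc.mono hsub)).add
        ((S.Ec.mono hsub).div_const θ))).div_const 2)
    (fun y hy => by
      have hy' : y ∈ Set.Ioo (0:ℝ) 1 := ⟨by linarith [hy.1], by linarith [hy.2]⟩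
      exact ((((S.dM y hy').const_mul θ).add ((S.dE y hy').div_const θ)).div_const 2))
  refine ⟨t, ht, (S.j_bound ⟨by linarith [ht.1], by linarith [ht.2]⟩ hθ).trans ?_⟩
  rw [he]
  apply le_of_eq
  have : x + v - x = v := by ring
  rw [this]
  ring


lemma lemA (S : Sys n L κ μ β h w k j M E) {d s : ℝ} (hd : 0 < d) (hd4 : κ * n * d ^ 4 = 1)
    (hs : 0 < s) (hs1 : s < 1) : M s ≤ 578 * d ^ 2 * E s := by
  have hn := S.hn
  have hM0 := S.M_nonneg hs.le hs1.le
  have hE0 := S.E_nonneg hs.le hs1.le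
  have small : ∀ r, 0 < r → r ≤ n * d → r ≤ 1 → M r ≤ d ^ 2 * E r := by
    intro r hr hrd hr1
    have := S.QM (Q := 1 / d ^ 2) hr hr1 (by
      have h1 : 1 / d ^ 2 ≤ n ^ 2 / r ^ 2 := by
        rw [div_le_div_iff₀ (by positivity) (by positivity)]
        have : r ^ 2 ≤ (n * d) ^ 2 := by gcongr
        nlinarith
      linarith [S.hL])
    have h2 : M r = d ^ 2 * (1 / d ^ 2 * M r) := by field_simp
    rw [h2]; gcongr
  by_cases hsR : s ≤ n * d
  · have := small s hs hsR hs1.le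
    have : 0 ≤ d ^ 2 * E s := by positivity
    linarith
  push Not at hsR
  have hR0 : 0 < n * d := by positivity
  have hR := small (n * d) hR0 le_rfl (by linarith)
  have hER := S.E_mono hR0.le hsR.le hs1.le
  set θ := 1 / (24 * d) with hθ
  have hθ0 : 0 < θ := by positivity
  set F := 3 / 2 * (θ * M s + E s / θ) with hF
  have hF0 : 0 ≤ F := by positivity
  have hmem : ∀ {a b x : ℝ}, n * d ≤ a → b ≤ s → x ∈ Set.Ioo a b → x ∈ Set.Ioo (0:ℝ) 1 :=
    fun ha hb hx => ⟨by linarith [hx.1], by linarith [hx.2]⟩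
  have hfF : ∀ {a b x : ℝ}, n * d ≤ a → b ≤ s → x ∈ Set.Ioo a b → pw n L x * h x ≤ F :=
    fun ha hb hx => S.sup_bound (hmem ha hb hx).1 (by linarith [hx.2]) hs1 hθ0
  have key := split_layer (M := M) (κ := κ) (μ := μ) (δ := d) (A := n * d) (B := s) (T := 1 / d ^ 2)
    (B1 := 3 * d * F) (F := F) S.hκ hR0 hsR.le hd
    (by
      rw [div_le_iff₀ (by positivity)]
      nlinarith)
    hF0
    (by
      intro a b ha hab hb
      exact slope_le hab (S.Mc.mono (Set.Icc_subset_Icc (by linarith) (by linarith)))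
        (fun x hx => S.dM x (hmem ha hb hx)) (fun x hx => hfF ha hb hx))
    (by
      intro a b ha hab hb hsg
      have hg := G0 (M := M) (f := fun x => pw n L x * h x) (j := j)
        (g := fun x => κ * (μ - x ^ 2) * (pw n L x * h x)) (a := a) (b := b) (w := d)
        (F := F) (Y := F / (3 * d)) (T := 1 / d ^ 2) hab hd (by positivity) (by positivity)
        (S.Mc.mono (Set.Icc_subset_Icc (by linarith) (by linarith)))
        (fun x hx => S.dM x (hmem ha hb hx))
        (fun x hx => mul_nonneg (S.p_pos (hmem ha hb hx).1).le (S.h0 x))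
        (fun x hx => hfF ha hb hx) hF0
        (fun x hx => S.dj x (hmem ha hb hx))
        (by
          have hnn : ∀ x ∈ Set.Ioo a b, 0 ≤ pw n L x * h x :=
            fun x hx => mul_nonneg (S.p_pos (hmem ha hb hx).1).le (S.h0 x)
          rcases hsg with hsg | hsg
          · left; intro x hx
            exact mul_le_mul_of_nonneg_right (hsg x hx) (hnn x hx)
          · right; intro x hx
            have := mul_le_mul_of_nonneg_right (hsg x hx) (hnn x hx)
            linarith)
        (by
          intro x hx hxb
          obtain ⟨t, ht, hjt⟩ := S.good_pt (x := x) (v := d) (θ := θ) (by linarith) hd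
            (by linarith) hθ0
          refine ⟨t, ht, hjt.trans ?_⟩
          have m1 := S.M_mono (a := x + d) (b := s) (by linarith) (by linarith) hs1.le
          have m2 := S.E_mono (a := x + d) (b := s) (by linarith) (by linarith) hs1.le
          have m3 := S.M_nonneg (a := x) (by linarith) (by linarith)
          have m4 := S.E_nonneg (a := x) (by linarith) (by linarith)
          have m5 : θ * (M (x + d) - M x) ≤ θ * M s := by gcongr; linarith
          have m6 : (E (x + d) - E x) / θ ≤ E s / θ := by gcongr; linarith
          have m7 : F / (3 * d) = (θ * M s + E s / θ) / 2 / d := by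
            rw [hF]; field_simp
          rw [m7]
          gcongr)
      have : 2 * (F / (3 * d)) / (1 / d ^ 2) = 2 / 3 * d * F := by field_simp
      rw [this] at hg
      have : 0 ≤ d * F := by positivity
      nlinarith)
  have h8 : 8 * d * F = M s / 2 + 288 * d ^ 2 * E s := by
    rw [hF, hθ]; field_simp; ring
  have : d ^ 2 * E (n * d) ≤ d ^ 2 * E s := by gcongr
  nlinarith

lemma k_lower (S : Sys n L κ μ β h w k j M E) {d s : ℝ} (hd : 0 < d) (hd4 : κ * n * d ^ 4 = 1)
    (hβ : β * d ^ 2 ≤ 1 / 1156) (hs : 0 < s) (hs1 : s < 1) :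
    E s + 2 * max (-β) 0 * M s ≤ 2 * k s := by
  have hA := S.lemA hd hd4 hs hs1
  have hM0 := S.M_nonneg hs.le hs1.le
  have hE0 := S.E_nonneg hs.le hs1.le
  rw [S.hk s ⟨hs, hs1⟩]
  rcases le_total β 0 with hb | hb
  · rw [max_eq_left (by linarith)]
    linarith
  · rw [max_eq_right (by linarith)]
    have : β * M s ≤ β * (578 * d ^ 2 * E s) := by gcongr
    have : (β * d ^ 2) * E s ≤ 1 / 1156 * E s := by gcongr
    linarith

lemma h_mono (S : Sys n L κ μ β h w k j M E) {d a b : ℝ} (hd : 0 < d) (hd4 : κ * n * d ^ 4 = 1)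
    (hβ : β * d ^ 2 ≤ 1 / 1156) (ha : 0 ≤ a) (hab : a ≤ b) (hb : b ≤ 1) : h a ≤ h b :=
  mono_aux hab (S.hc.mono (Set.Icc_subset_Icc ha hb))
    (fun x hx => S.dh x ⟨by linarith [hx.1], by linarith [hx.2]⟩)
    (fun x hx => by
      have hx0 : 0 < x := by linarith [hx.1]
      have hx1 : x < 1 := by linarith [hx.2]
      have := S.k_lower hd hd4 hβ hx0 hx1
      have := S.E_nonneg hx0.le hx1.le
      have := mul_nonneg (le_max_right (-β) 0) (S.M_nonneg hx0.le hx1.le)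
      exact div_nonneg (by linarith) (S.p_pos hx0).le)

lemma star (S : Sys n L κ μ β h w k j M E) {d s η : ℝ} (hd : 0 < d) (hd4 : κ * n * d ^ 4 = 1)
    (hβ : β * d ^ 2 ≤ 1 / 1156) (hs1 : s ≤ 1) (hη : 0 < η) (hη2 : η ≤ s / 2) :
    E (s - η) + 2 * max (-β) 0 * M (s - η) ≤ 2 * (pw n L s * h s) / η := by
  have hs : 0 < s := by linarith
  have hP := S.p_pos hs
  set X := E (s - η) + 2 * max (-β) 0 * M (s - η) with hX
  have := mono_aux (F := fun x => h x - X / (2 * pw n L s) * x)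
    (F' := fun x => 2 * k x / pw n L x - X / (2 * pw n L s) * 1) (a := s - η) (b := s)
    (by linarith)
    ((S.hc.mono (Set.Icc_subset_Icc (by linarith) hs1)).sub
      (continuousOn_const.mul continuousOn_id))
    (fun x hx => (S.dh x ⟨by linarith [hx.1], by linarith [hx.2]⟩).sub
      ((hasDerivAt_id x).const_mul _))
    (fun x hx => by
      have hx0 : 0 < x := by linarith [hx.1]
      have hx1 : x < 1 := by linarith [hx.2]
      have h1 := S.k_lower hd hd4 hβ hx0 hx1
      have h2 := S.E_mono (a := s - η) (by linarith) hx.1.le hx1.le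
      have h3 := S.M_mono (a := s - η) (by linarith) hx.1.le hx1.le
      have h4 := mul_le_mul_of_nonneg_left h3 (le_max_right (-β) 0)
      have h5 : X ≤ 2 * k x := by rw [hX]; linarith
      have hX0 : 0 ≤ X := by
        have := S.E_nonneg (a := s - η) (by linarith) (by linarith)
        have := mul_nonneg (le_max_right (-β) 0)
          (S.M_nonneg (a := s - η) (by linarith) (by linarith))
        rw [hX]; linarith
      have hp := S.p_pos hx0
      have h6 := S.p_upper hx0 hx.2.le (by linarith [hx.1])
      have hk0 : 0 ≤ 2 * k x := by linarith
      have : X / (2 * pw n L s) ≤ 2 * k x / pw n L x := by gcongr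
      linarith)
  have hh := S.h0 (s - η)
  have h7 : X / (2 * pw n L s) * η ≤ h s := by linarith
  rw [le_div_iff₀ hη]
  have : X / (2 * pw n L s) * η * (2 * pw n L s) ≤ h s * (2 * pw n L s) := by gcongr
  have h8 : X / (2 * pw n L s) * η * (2 * pw n L s) = X * η := by field_simp
  linarith

lemma ph_le (S : Sys n L κ μ β h w k j M E) {d s x : ℝ} (hd : 0 < d) (hd4 : κ * n * d ^ 4 = 1)
    (hβ : β * d ^ 2 ≤ 1 / 1156) (hs : 0 < s) (hs1 : s ≤ 1) (hx : s / 2 ≤ x) (hxs : x ≤ s) :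
    pw n L x * h x ≤ 2 * (pw n L s * h s) := by
  have hx0 : 0 < x := by linarith
  have h1 := S.p_upper hx0 hxs hx
  have h2 := S.h_mono hd hd4 hβ hx0.le hxs hs1
  have := S.h0 x
  have := S.p_pos hs
  calc _ ≤ (2 * pw n L s) * h s := by gcongr
    _ = _ := by ring

lemma M_len (S : Sys n L κ μ β h w k j M E) {d s a b : ℝ} (hd : 0 < d) (hd4 : κ * n * d ^ 4 = 1)
    (hβ : β * d ^ 2 ≤ 1 / 1156) (hs : 0 < s) (hs1 : s ≤ 1) (ha : s / 2 ≤ a) (hab : a ≤ b)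
    (hb : b ≤ s) : M b - M a ≤ 2 * (pw n L s * h s) * (b - a) :=
  slope_le hab (S.Mc.mono (Set.Icc_subset_Icc (by linarith) (by linarith)))
    (fun x hx => S.dM x ⟨by linarith [hx.1], by linarith [hx.2]⟩)
    (fun x hx => S.ph_le hd hd4 hβ hs hs1 (by linarith [hx.1]) (by linarith [hx.2]))

lemma lemQ (S : Sys n L κ μ β h w k j M E) {d s v : ℝ} (hd : 0 < d) (hd4 : κ * n * d ^ 4 = 1)
    (hβ : β * d ^ 2 ≤ 1 / 1156) (hs : 0 < s) (hs1 : s ≤ 1) (hv : 0 < v)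
    (hQ : ∀ t, 0 < t → t < s → v ^ 2 * M t ≤ E t + 2 * max (-β) 0 * M t) :
    (M s - M (s / 2)) * v ≤ 4 * (pw n L s * h s) := by
  set H := pw n L s * h s with hH
  have hH0 : 0 ≤ H := mul_nonneg (S.p_pos hs).le (S.h0 s)
  by_cases hc : 1 / v ≤ s / 2
  · have hη : 0 < 1 / v := by positivity
    have h1 := S.star hd hd4 hβ hs1 hη hc
    have h2 := hQ (s - 1 / v) (by linarith) (by linarith)
    have h3 := S.M_len hd hd4 hβ hs hs1 (a := s - 1 / v) (b := s) (by linarith) (by linarith) le_rfl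
    have h4 := S.M_nonneg (a := s / 2) (by linarith) (by linarith)
    rw [← hH] at h1 h3
    have h5 : v ^ 2 * M (s - 1 / v) ≤ 2 * H * v := by
      have : 2 * H / (1 / v) = 2 * H * v := by field_simp
      linarith
    have h6 : M (s - 1 / v) * v ≤ 2 * H := by
      have : (M (s - 1 / v) * v) * v ≤ 2 * H * v := by linarith
      exact le_of_mul_le_mul_right this hv
    have h7 : (M s - M (s - 1 / v)) * v ≤ 2 * H * (s - (s - 1 / v)) * v := by gcongr
    have h8 : 2 * H * (s - (s - 1 / v)) * v = 2 * H := by field_simp; ring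
    have : 0 ≤ M (s / 2) * v := by positivity
    linarith
  · push Not at hc
    have h3 := S.M_len hd hd4 hβ hs hs1 (a := s / 2) (b := s) le_rfl (by linarith) le_rfl
    rw [← hH] at h3
    have h7 : (M s - M (s / 2)) * v ≤ 2 * H * (s - s / 2) * v := by gcongr
    have h8 : s / 2 * v ≤ 1 := by rw [lt_div_iff₀ hv] at hc; exact hc.le
    nlinarith

lemma lemG (S : Sys n L κ μ β h w k j M E) {d s a b v : ℝ} (hd : 0 < d) (hd4 : κ * n * d ^ 4 = 1)
    (hβ : β * d ^ 2 ≤ 1 / 1156) (hs : 0 < s) (hs1 : s ≤ 1) (ha : s / 2 ≤ a) (hab : a ≤ b)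
    (hb : b ≤ s) (hv : 0 < v)
    (hsg : (∀ x ∈ Set.Ioo a b, 1 / v ^ 2 ≤ κ * (μ - x ^ 2)) ∨
      (∀ x ∈ Set.Ioo a b, 1 / v ^ 2 ≤ - (κ * (μ - x ^ 2)))) :
    M b - M a ≤ 10 * (pw n L s * h s) * v := by
  set H := pw n L s * h s with hH
  have hH0 : 0 ≤ H := mul_nonneg (S.p_pos hs).le (S.h0 s)
  by_cases hc : b - a ≤ 3 * v
  · have h3 := S.M_len hd hd4 hβ hs hs1 ha hab hb
    rw [← hH] at h3
    nlinarith
  push Not at hc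
  have hlast := S.M_len hd hd4 hβ hs hs1 (a := b - v) (b := b) (by linarith) (by linarith) hb
  rw [← hH] at hlast
  have hstar := S.star hd hd4 hβ hs1 hv (by linarith)
  rw [← hH] at hstar
  have hmem : ∀ {x : ℝ}, x ∈ Set.Ioo a (b - v) → x ∈ Set.Ioo (0:ℝ) 1 :=
    fun hx => ⟨by linarith [hx.1], by linarith [hx.2]⟩
  have hnn : ∀ x ∈ Set.Ioo a (b - v), 0 ≤ pw n L x * h x :=
            fun x hx => mul_nonneg (S.p_pos (hmem hx).1).le (S.h0 x)
  have hg := G0 (M := M) (f := fun x => pw n L x * h x) (j := j)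
        (g := fun x => κ * (μ - x ^ 2) * (pw n L x * h x)) (a := a) (b := b - v) (w := v)
        (F := 2 * H) (Y := 2 * H / v) (T := 1 / v ^ 2) (by linarith) hv (by positivity)
        (by positivity)
        (S.Mc.mono (Set.Icc_subset_Icc (by linarith) (by linarith)))
        (fun x hx => S.dM x (hmem hx))
        hnn
        (fun x hx => S.ph_le hd hd4 hβ hs hs1 (by linarith [hx.1]) (by linarith [hx.2]))
        (by positivity)
        (fun x hx => S.dj x (hmem hx))
        (by
          rcases hsg with hsg | hsg
          · left; intro x hx
            exact mul_le_mul_of_nonneg_right (hsg x ⟨hx.1, by linarith [hx.2]⟩) (hnn x hx)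
          · right; intro x hx
            have := mul_le_mul_of_nonneg_right (hsg x ⟨hx.1, by linarith [hx.2]⟩) (hnn x hx)
            linarith)
        (by
          intro x hx hxb
          obtain ⟨t, ht, hjt⟩ := S.good_pt (x := x) (v := v) (θ := 1 / v) (by linarith) hv
            (by linarith) (by positivity)
          refine ⟨t, ht, hjt.trans ?_⟩
          have m1 := S.M_len hd hd4 hβ hs hs1 (a := x) (b := x + v) (by linarith) (by linarith)
            (by linarith)
          rw [← hH] at m1
          have m2 := S.E_mono (a := x + v) (b := s - v) (by linarith) (by linarith) (by linarith)
          have m4 := S.E_nonneg (a := x) (by linarith) (by linarith)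
          have m3 := mul_nonneg (le_max_right (-β) 0) (S.M_nonneg (a := s - v) (by linarith) (by linarith))
          have m5 : 1 / v * (M (x + v) - M x) ≤ 1 / v * (2 * H * (x + v - x)) := by gcongr
          have m5' : 1 / v * (2 * H * (x + v - x)) = 2 * H := by field_simp; ring
          have m6 : (E (x + v) - E x) / (1 / v) ≤ (2 * H / v) / (1 / v) := by
            gcongr; linarith
          have m6' : (2 * H / v) / (1 / v) = 2 * H := by field_simp
          gcongr
          linarith)
  have e1 : 2 * (2 * H / v) / (1 / v ^ 2) = 4 * H * v := by field_simp; ring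
  rw [e1] at hg
  nlinarith

lemma step1 (S : Sys n L κ μ β h w k j M E) {d s δ : ℝ} (hd : 0 < d) (hd4 : κ * n * d ^ 4 = 1)
    (hβ : β * d ^ 2 ≤ 1 / 1156) (hs : 0 < s) (hs1 : s ≤ 1) (hδ : 0 < δ) (hδ3 : κ * s * δ ^ 3 = 1) :
    M s - M (s / 2) ≤ 44 * (pw n L s * h s) * δ := by
  set H := pw n L s * h s with hH
  have hH0 : 0 ≤ H := mul_nonneg (S.p_pos hs).le (S.h0 s)
  have key := split_layer (M := M) (κ := κ) (μ := μ) (δ := δ) (A := s / 2) (B := s)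
    (T := 1 / (2 * δ) ^ 2) (B1 := 10 * H * (2 * δ)) (F := 2 * H) S.hκ (by linarith) (by linarith) hδ
    (by
      rw [div_le_iff₀ (by positivity)]
      nlinarith)
    (by positivity)
    (fun a b ha hab hb => S.M_len hd hd4 hβ hs hs1 ha hab hb)
    (fun a b ha hab hb hsg => S.lemG hd hd4 hβ hs hs1 ha hab hb (by positivity) hsg)
  linarith

lemma step2 (S : Sys n L κ μ β h w k j M E) {d s v : ℝ} (hd : 0 < d) (hd4 : κ * n * d ^ 4 = 1)
    (hβ : β * d ^ 2 ≤ 1 / 1156) (hs : 0 < s) (hs1 : s ≤ 1) (hv : 0 < v)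
    (hv2 : κ * |μ - s ^ 2| * v ^ 2 = 1) :
    M s - M (s / 2) ≤ 10000 * (pw n L s * h s) * v := by
  set H := pw n L s * h s with hH
  have hH0 : 0 ≤ H := mul_nonneg (S.p_pos hs).le (S.h0 s)
  have hκ := S.hκ
  have hHv : 0 ≤ H * v := by positivity
  rcases le_total 0 (μ - s ^ 2) with hμ | hμ
  · rw [abs_of_nonneg hμ] at hv2
    have := S.lemG hd hd4 hβ hs hs1 (a := s / 2) (b := s) le_rfl (by linarith) le_rfl hv (by
      left
      intro x hx
      have e : 1 / v ^ 2 = κ * (μ - s ^ 2) := by field_simp; linarith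
      rw [e]
      have : x ^ 2 ≤ s ^ 2 := by nlinarith [hx.1, hx.2]
      gcongr)
    linarith
  rw [abs_of_nonpos hμ] at hv2
  set D := s ^ 2 - μ with hD
  have hD0 : 0 < D := by
    by_contra hneg
    have : D = 0 := by linarith
    rw [show -(μ - s ^ 2) = D by rw [hD]; ring, this] at hv2
    simp at hv2
  rw [show -(μ - s ^ 2) = D by rw [hD]; ring] at hv2
  have hδex : ∀ t : ℝ, 0 < t → ∃ δ : ℝ, 0 < δ ∧ κ * t * δ ^ 3 = 1 := by
    intro t ht
    refine ⟨(κ * t) ^ (-(1:ℝ)/3), by positivity, ?_⟩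
    rw [← Real.rpow_natCast, ← Real.rpow_mul (by positivity)]
    norm_num
    rw [Real.rpow_neg_one]
    field_simp
  obtain ⟨δ, hδ, hδ3⟩ := hδex s hs
  by_cases hc : D ≤ s * δ
  · have h1 := S.step1 hd hd4 hβ hs hs1 hδ hδ3
    have : δ ≤ v := by
      have : δ ^ 2 ≤ v ^ 2 := by
        have : κ * D * δ ^ 2 ≤ κ * D * v ^ 2 := by
          rw [hv2, ← hδ3]
          have : κ * D * δ ^ 2 ≤ κ * (s * δ) * δ ^ 2 := by gcongr
          linarith
        exact le_of_mul_le_mul_left this (by positivity)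
      exact le_of_sq_le_sq this hv.le
    have : H * δ ≤ H * v := by gcongr
    rw [← hH] at h1
    linarith
  push Not at hc
  set τ := min (D / (4 * s)) (s / 2) with hτ
  have hτ0 : 0 < τ := lt_min (by positivity) (by positivity)
  have hτs : τ ≤ s / 2 := min_le_right _ _
  have hτD : τ * (4 * s) ≤ D := by
    rw [← le_div_iff₀ (by positivity)]; exact min_le_left _ _
  have h2 := S.lemG hd hd4 hβ hs hs1 (a := s - τ) (b := s) (v := 2 * v) (by linarith) (by linarith)
    le_rfl (by linarith) (by
      right
      intro x hx
      have e : 1 / (2 * v) ^ 2 = κ * (D / 4) := by field_simp; linarith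
      rw [e, ← mul_neg]
      have : D / 4 ≤ -(μ - x ^ 2) := by nlinarith [hx.1, hx.2]
      gcongr)
  rw [← hH] at h2
  by_cases hc2 : D / (4 * s) ≤ s / 2
  swap
  · have : τ = s / 2 := min_eq_right (by linarith)
    rw [this, show s - s / 2 = s / 2 by ring] at h2
    linarith
  have hτe : τ = D / (4 * s) := min_eq_left hc2
  obtain ⟨t, ht, hte⟩ := exists_hasDerivAt_eq_slope M (fun x => pw n L x * h x)
    (show s - τ < s by linarith) (S.Mc.mono (Set.Icc_subset_Icc (by linarith) hs1))
    (fun x hx => S.dM x ⟨by linarith [hx.1], by linarith [hx.2]⟩)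
  have ht0 : 0 < t := by linarith [ht.1]
  obtain ⟨δt, hδt, hδt3⟩ := hδex t ht0
  have h3 := S.step1 hd hd4 hβ ht0 (by linarith [ht.2]) hδt hδt3
  have hδδ : δt ≤ 2 * δ := by
    by_contra hcon
    push Not at hcon
    have : (2 * δ) ^ 3 < δt ^ 3 := by gcongr
    have h5 : κ * t * (2 * δ) ^ 3 < 1 := by rw [← hδt3]; gcongr
    have h6 : κ * (s / 2) * (2 * δ) ^ 3 ≤ κ * t * (2 * δ) ^ 3 := by gcongr; linarith [ht.1]
    nlinarith
  rw [hte] at h3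
  have h4 : M (s - τ) ≤ M t := S.M_mono (by linarith) ht.1.le (by linarith [ht.2])
  have h5 : M (t / 2) ≤ M (s / 2) := S.M_mono (by linarith) (by linarith [ht.2]) (by linarith)
  have h6 : (M s - M (s - τ)) / (s - (s - τ)) ≤ 20 * (H * v) / τ := by
    rw [show s - (s - τ) = τ by ring]; gcongr; linarith
  have h7 : 44 * ((M s - M (s - τ)) / (s - (s - τ))) * δt ≤ 44 * (20 * (H * v) / τ) * (2 * δ) := by
    gcongr
  have h8 : δ / τ ≤ 4 := by
    rw [hτe, div_div_eq_mul_div, div_le_iff₀ hD0]; linarith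
  have h9 : 44 * (20 * (H * v) / τ) * (2 * δ) = 1760 * (H * v) * (δ / τ) := by
    field_simp; ring
  have h10 : 1760 * (H * v) * (δ / τ) ≤ 1760 * (H * v) * 4 := by gcongr
  linarith

lemma final (S : Sys n L κ μ β h w k j M E) {d s : ℝ} (hd : 0 < d) (hd4 : κ * n * d ^ 4 = 1)
    (hβ : β * d ^ 2 ≤ 1 / 1156) (hs : 0 < s) (hs1 : s ≤ 1) :
    (M s - M (s / 2)) * (Real.sqrt (κ * |μ - s ^ 2|) + Real.sqrt |β| + (κ * s) ^ ((1:ℝ)/3)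
      + Real.sqrt L + n / s) ≤ 10200 * (pw n L s * h s) := by
  set H := pw n L s * h s with hH
  have hH0 : 0 ≤ H := mul_nonneg (S.p_pos hs).le (S.h0 s)
  have hκ := S.hκ
  have hn := S.hn
  have hL := S.hL
  set N := M s - M (s / 2) with hN
  have hN0 : 0 ≤ N := by
    have := S.M_mono (a := s / 2) (b := s) (by linarith) (by linarith) hs1
    linarith
  have hMn : ∀ t, 0 < t → t < s → 0 ≤ max (-β) 0 * M t := fun t ht hts =>
    mul_nonneg (le_max_right _ _) (S.M_nonneg ht.le (by linarith))
  have a1 : N * Real.sqrt (κ * |μ - s ^ 2|) ≤ 10000 * H := by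
    set x := Real.sqrt (κ * |μ - s ^ 2|) with hx
    have hx2 : x ^ 2 = κ * |μ - s ^ 2| := Real.sq_sqrt (by positivity)
    rcases (Real.sqrt_nonneg (κ * |μ - s ^ 2|)).eq_or_lt with h0 | h0
    · rw [← hx] at h0; rw [← h0]; linarith
    · rw [← hx] at h0
      have := S.step2 (v := 1 / x) hd hd4 hβ hs hs1 (by positivity) (by rw [← hx2]; field_simp)
      rw [← hH, ← hN] at this
      have := mul_le_mul_of_nonneg_right this h0.le
      have e : 10000 * H * (1 / x) * x = 10000 * H := by field_simp
      linarith
  have a2 : N * (κ * s) ^ ((1:ℝ)/3) ≤ 44 * H := by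
    set x := (κ * s) ^ ((1:ℝ)/3) with hx
    have h0 : 0 < x := by positivity
    have hx3 : x ^ 3 = κ * s := by
      rw [hx, ← Real.rpow_natCast, ← Real.rpow_mul (by positivity)]; norm_num
    have := S.step1 (δ := 1 / x) hd hd4 hβ hs hs1 (by positivity) (by rw [← hx3]; field_simp)
    rw [← hH, ← hN] at this
    have := mul_le_mul_of_nonneg_right this h0.le
    have e : 44 * H * (1 / x) * x = 44 * H := by field_simp
    linarith
  have a3 : N * Real.sqrt L ≤ 4 * H := by
    rcases (Real.sqrt_nonneg L).eq_or_lt with h0 | h0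
    · rw [← h0]; linarith
    · refine S.lemQ hd hd4 hβ hs hs1 h0 (fun t ht hts => ?_)
      have := S.QM (s := t) (Q := Real.sqrt L ^ 2) ht (by linarith) (by
        rw [Real.sq_sqrt hL]
        have : 0 ≤ n ^ 2 / t ^ 2 := by positivity
        linarith)
      have := hMn t ht hts
      linarith
  have a4 : N * (n / s) ≤ 4 * H := by
    refine S.lemQ hd hd4 hβ hs hs1 (by positivity) (fun t ht hts => ?_)
    have := S.QM (s := t) (Q := (n / s) ^ 2) ht (by linarith) (by
      have : (n / s) ^ 2 ≤ n ^ 2 / t ^ 2 := by rw [div_pow]; gcongr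
      linarith)
    have := hMn t ht hts
    linarith
  have a5 : N * Real.sqrt |β| ≤ 48 * H := by
    rcases lt_or_ge β 0 with hb | hb
    · rw [abs_of_neg hb]
      have : N * Real.sqrt (-β) ≤ 4 * H := by
        refine S.lemQ hd hd4 hβ hs hs1 (Real.sqrt_pos.2 (by linarith)) (fun t ht hts => ?_)
        rw [Real.sq_sqrt (by linarith), max_eq_left (by linarith)]
        have := S.E_nonneg ht.le (by linarith)
        have := mul_nonneg (show 0 ≤ -β by linarith) (S.M_nonneg ht.le (by linarith))
        linarith
      linarith
    · rw [abs_of_nonneg hb]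
      have b1 : Real.sqrt β ≤ 1 / d := by
        apply Real.sqrt_le_iff.2
        refine ⟨by positivity, ?_⟩
        rw [div_pow, one_pow, le_div_iff₀ (by positivity)]
        linarith
      have b2 : 1 / d ≤ (κ * s) ^ ((1:ℝ)/3) + n / s := by
        have p1 : 0 < (κ * s) ^ ((1:ℝ)/3) := by positivity
        have p2 : 0 < n / s := by positivity
        by_cases hc : 1 / d ≤ n / s
        · linarith
        · push Not at hc
          rw [div_lt_div_iff₀ hs hd] at hc
          have : 1 / d ≤ (κ * s) ^ ((1:ℝ)/3) := by
            have e : (1 / d) = ((1 / d) ^ 3) ^ ((1:ℝ)/3) := by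
              rw [← Real.rpow_natCast, ← Real.rpow_mul (by positivity)]; norm_num
            rw [e]
            gcongr
            rw [div_pow, one_pow, div_le_iff₀ (by positivity)]
            have : κ * (n * d) * d ^ 3 ≤ κ * (1 * s) * d ^ 3 := by gcongr
            nlinarith
          linarith
      have : N * Real.sqrt β ≤ N * ((κ * s) ^ ((1:ℝ)/3) + n / s) := by gcongr; linarith
      linarith
  linarith

end Sys

lemma exists_prim {f : ℝ → ℝ} (hf : ContinuousOn f (Set.Icc 0 1)) :
    ∃ Φ : ℝ → ℝ, Continuous Φ ∧ Φ 0 = 0 ∧ (∀ r ∈ Set.Ioo (0:ℝ) 1, HasDerivAt Φ (f r) r) ∧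
      ∀ s ∈ Set.Ioc (0:ℝ) 1, ∫ r in Set.Ioo (0:ℝ) s, f r = Φ s := by
  set g := Set.IccExtend (zero_le_one (α := ℝ)) ((Set.Icc (0:ℝ) 1).domRestrict f) with hg
  have gc : Continuous g := hf.domRestrict.Icc_extend'
  have ge : ∀ r ∈ Set.Icc (0:ℝ) 1, g r = f r := fun r hr => by
    rw [hg, Set.IccExtend_of_mem _ _ hr]; rfl
  have hd : ∀ r, HasDerivAt (fun x => ∫ t in (0:ℝ)..x, g t) (g r) r := fun r =>
    intervalIntegral.integral_hasDerivAt_right (gc.intervalIntegrable _ _)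
      gc.stronglyMeasurable.stronglyMeasurableAtFilter gc.continuousAt
  refine ⟨fun x => ∫ t in (0:ℝ)..x, g t, ?_, by simp, ?_, ?_⟩
  · exact continuous_iff_continuousAt.2 fun r => (hd r).continuousAt
  · intro r hr
    rw [← ge r ⟨hr.1.le, hr.2.le⟩]; exact hd r
  · intro s hs
    simp only
    rw [intervalIntegral.integral_of_le hs.1.le, MeasureTheory.integral_Ioc_eq_integral_Ioo]
    apply MeasureTheory.setIntegral_congr_fun measurableSet_Ioo
    intro r hr
    exact (ge r ⟨hr.1.le, by linarith [hr.2, hs.2]⟩).symm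

/-- the weighted bound in terms of the primitive -/
lemma weight_bound {n L κ μ β : ℝ} {h w k j M E I : ℝ → ℝ} (S : Sys n L κ μ β h w k j M E) {d s : ℝ}
    (hd : 0 < d) (hd4 : κ * n * d ^ 4 = 1)
    (hβ : β * d ^ 2 ≤ 1 / 1156) (hs : 0 < s) (hs1 : s ≤ 1)
    (Ic : Continuous I) (I0 : I 0 = 0) (dI : ∀ r ∈ Set.Ioo (0:ℝ) 1, HasDerivAt I (h r * r) r) :
    I s * pw n L s ≤ 2 * s * (M s - M (s / 2)) := by
  have hP := S.p_pos hs
  have h1 := slope_le (F := I) (F' := fun r => h r * r) (a := 0) (b := s / 2)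
    (B := h (s / 2) * (s / 2)) (by linarith) Ic.continuousOn
    (fun x hx => dI x ⟨hx.1, by linarith [hx.2]⟩)
    (fun x hx => by
      have := S.h_mono hd hd4 hβ hx.1.le hx.2.le (by linarith)
      have := S.h0 x
      have := S.h0 (s / 2)
      have := hx.1
      have := hx.2
      gcongr)
  have h2 := slope_le (F := fun r => - I r) (F' := fun r => -(h r * r)) (a := s / 2) (b := s)
    (B := -(h (s / 2) * (s / 2))) (by linarith) Ic.neg.continuousOn
    (fun x hx => (dI x ⟨by linarith [hx.1], by linarith [hx.2]⟩).neg)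
    (fun x hx => by
      have := S.h_mono hd hd4 hβ (by linarith) hx.1.le (by linarith [hx.2])
      have := S.h0 x
      have := S.h0 (s / 2)
      have := hx.1
      have := hx.2
      have : h (s / 2) * (s / 2) ≤ h x * x := by gcongr
      linarith)
  have h3 := mono_aux (F := fun r => s * M r - pw n L s * I r)
    (F' := fun r => s * (pw n L r * h r) - pw n L s * (h r * r)) (a := s / 2) (b := s)
    (by linarith)
    ((continuousOn_const.mul (S.Mc.mono (Set.Icc_subset_Icc (by linarith) hs1))).sub
      (continuousOn_const.mul Ic.continuousOn))
    (fun x hx => ((S.dM x ⟨by linarith [hx.1], by linarith [hx.2]⟩).const_mul s).sub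
      ((dI x ⟨by linarith [hx.1], by linarith [hx.2]⟩).const_mul _))
    (fun x hx => by
      have := S.p_lower (by linarith [hx.1]) hx.2.le
      have := mul_le_mul_of_nonneg_right this (S.h0 x)
      linarith)
  rw [I0] at h1
  have h4 : I s ≤ 2 * (I s - I (s / 2)) := by linarith
  have := mul_le_mul_of_nonneg_right h4 hP.le
  linarith

/-- regularity and reduction to a first order system -/
lemma reg {U : ℝ → ℂ} (hU : ContDiffOn ℝ (⊤ : ℕ∞) U (Set.Icc 0 1)) :
    ∃ V : ℝ → ℂ, ContinuousOn V (Set.Icc 0 1) ∧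
      (∀ r ∈ Set.Ioo (0:ℝ) 1, V r = deriv U r) ∧
      (∀ r ∈ Set.Ioo (0:ℝ) 1, HasDerivAt U (V r) r) ∧
      (∀ r ∈ Set.Ioo (0:ℝ) 1, HasDerivAt V (deriv (deriv U) r) r) ∧
      ∃ K, ∀ r ∈ Set.Icc (0:ℝ) 1, ‖U r - U 0‖ ≤ K * r := by
  have hud := uniqueDiffOn_Icc (zero_lt_one (α := ℝ))
  have hat : ∀ r ∈ Set.Ioo (0:ℝ) 1, ContDiffAt ℝ (⊤ : ℕ∞) U r := fun r hr =>
    hU.contDiffAt (Icc_mem_nhds hr.1 hr.2)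
  have hVd : ∀ r ∈ Set.Ioo (0:ℝ) 1, derivWithin U (Set.Icc 0 1) r = deriv U r := fun r hr =>
    derivWithin_of_mem_nhds (Icc_mem_nhds hr.1 hr.2)
  have hVc : ContinuousOn (derivWithin U (Set.Icc 0 1)) (Set.Icc 0 1) :=
    hU.continuousOn_derivWithin hud (by simp)
  refine ⟨derivWithin U (Set.Icc 0 1), hVc, hVd, ?_, ?_, ?_⟩
  · intro r hr
    rw [hVd r hr]
    exact ((hat r hr).differentiableAt (by simp)).hasDerivAt
  · intro r hr
    have h1 : ContDiffAt ℝ 1 (deriv U) r := 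
      ((hU.mono Set.Ioo_subset_Icc_self).deriv_of_isOpen (m := 1) isOpen_Ioo
        (by norm_cast)).contDiffAt (Ioo_mem_nhds hr.1 hr.2)
    have h2 : HasDerivAt (deriv U) (deriv (deriv U) r) r :=
      (h1.differentiableAt (by simp)).hasDerivAt
    refine h2.congr_of_eventuallyEq ?_
    filter_upwards [Ioo_mem_nhds hr.1 hr.2] with x hx
    exact hVd x hx
  · obtain ⟨K, hK⟩ := isCompact_Icc.exists_bound_of_continuousOn hVc
    refine ⟨K, fun r hr => ?_⟩
    have := (convex_Icc (0:ℝ) 1).norm_image_sub_le_of_norm_derivWithin_le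
      (hU.differentiableOn (by simp)) hK (Set.left_mem_Icc.2 zero_le_one) hr
    rwa [sub_zero, Real.norm_of_nonneg hr.1] at this

lemma mkSys {n l : ℝ} {κ μ β g : ℝ} {u v u1 v1 u2 v2 : ℝ → ℝ} {K : ℝ}
    (hn : 1 ≤ n) (hκ : 0 < κ) (hg : g = κ ∨ g = -κ)
    (uc : ContinuousOn u (Set.Icc 0 1)) (vc : ContinuousOn v (Set.Icc 0 1))
    (u1c : ContinuousOn u1 (Set.Icc 0 1)) (v1c : ContinuousOn v1 (Set.Icc 0 1))
    (du : ∀ r ∈ Set.Ioo (0:ℝ) 1, HasDerivAt u (u1 r) r)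
    (dv : ∀ r ∈ Set.Ioo (0:ℝ) 1, HasDerivAt v (v1 r) r)
    (du1 : ∀ r ∈ Set.Ioo (0:ℝ) 1, HasDerivAt u1 (u2 r) r)
    (dv1 : ∀ r ∈ Set.Ioo (0:ℝ) 1, HasDerivAt v1 (v2 r) r)
    (eu : ∀ r ∈ Set.Ioo (0:ℝ) 1, u2 r = (-1 / r + 2 * r * l ^ 2 / (n ^ 2 + r ^ 2 * l ^ 2)) * u1 r
      + (n ^ 2 / r ^ 2 + l ^ 2 - β) * u r - g * (μ - r ^ 2) * v r)
    (ev : ∀ r ∈ Set.Ioo (0:ℝ) 1, v2 r = (-1 / r + 2 * r * l ^ 2 / (n ^ 2 + r ^ 2 * l ^ 2)) * v1 r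
      + (n ^ 2 / r ^ 2 + l ^ 2 - β) * v r + g * (μ - r ^ 2) * u r)
    (u0 : u 0 = 0) (v0 : v 0 = 0)
    (hK : ∀ r ∈ Set.Icc (0:ℝ) 1, u r ^ 2 + v r ^ 2 ≤ K * r ^ 2) :
    ∃ w k j M E : ℝ → ℝ, Sys n (l ^ 2) κ μ β (fun r => u r ^ 2 + v r ^ 2) w k j M E := by
  set L := l ^ 2 with hLdef
  have hL : 0 ≤ L := sq_nonneg l
  have den : ∀ r, 0 < n ^ 2 + r ^ 2 * L := fun r => by positivity
  have pc : Continuous (pw n L) := by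
    unfold pw
    exact continuous_id.div (by fun_prop) (fun r => (den r).ne')
  have dp : ∀ r, 0 < r → HasDerivAt (pw n L)
      (pw n L r * (1 / r - 2 * r * L / (n ^ 2 + r ^ 2 * L))) r := by
    intro r hr
    have h1 := den r
    have := (hasDerivAt_id r).div (((hasDerivAt_pow 2 r).mul_const L).const_add (n ^ 2)) h1.ne'
    refine HasDerivAt.congr_deriv (f := pw n L) this ?_
    unfold pw
    simp only [id]
    field_simp
    ring
  have hp : ∀ r, 0 < r → 0 < pw n L r := fun r hr => div_pos hr (den r)
  have pid : ∀ r, 0 < r → pw n L r * (n ^ 2 / r ^ 2 + L) = 1 / r := by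
    intro r hr
    have := den r
    unfold pw
    field_simp
  have hc : ContinuousOn (fun r => u r ^ 2 + v r ^ 2) (Set.Icc 0 1) := (uc.pow 2).add (vc.pow 2)
  have wc : ContinuousOn (fun r => u1 r ^ 2 + v1 r ^ 2) (Set.Icc 0 1) := (u1c.pow 2).add (v1c.pow 2)
  have hrc : ContinuousOn (fun r => (u r ^ 2 + v r ^ 2) / r) (Set.Icc 0 1) := by
    intro r hr
    rcases hr.1.eq_or_lt with h0 | h0
    · subst h0
      rw [ContinuousWithinAt]
      simp only [div_zero]
      have h2 : Filter.Tendsto (fun r : ℝ => K * r) (nhdsWithin 0 (Set.Icc 0 1)) (nhds 0) := by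
        have : ContinuousWithinAt (fun r : ℝ => K * r) (Set.Icc 0 1) 0 := by fun_prop
        simpa [ContinuousWithinAt] using this
      refine tendsto_of_tendsto_of_tendsto_of_le_of_le' tendsto_const_nhds h2 ?_ ?_
      · filter_upwards [self_mem_nhdsWithin] with x hx
        have := hx.1
        positivity
      · filter_upwards [self_mem_nhdsWithin] with x hx
        rcases hx.1.eq_or_lt with h | h
        · rw [← h]; simp
        · rw [div_le_iff₀ h]
          have := hK x hx
          nlinarith
    · exact (hc r hr).div continuousWithinAt_id h0.ne'
  obtain ⟨M, Mc, M0, dM, -⟩ := exists_prim (pc.continuousOn.mul hc)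
  obtain ⟨E, Ec, E0, dE, -⟩ := exists_prim ((pc.continuousOn.mul wc).add hrc)
  simp only [Pi.mul_apply, Pi.add_apply] at dM dE
  set k : ℝ → ℝ := fun r => pw n L r * (u r * u1 r + v r * v1 r) with hk
  have dk : ∀ r ∈ Set.Ioo (0:ℝ) 1, HasDerivAt k
      ((pw n L r * (u1 r ^ 2 + v1 r ^ 2) + (u r ^ 2 + v r ^ 2) / r)
        - β * (pw n L r * (u r ^ 2 + v r ^ 2))) r := by
    intro r hr
    have := (dp r hr.1).mul (((du r hr).mul (du1 r hr)).add ((dv r hr).mul (dv1 r hr)))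
    refine HasDerivAt.congr_deriv (f := k) this ?_
    have e : (u r ^ 2 + v r ^ 2) / r = pw n L r * (n ^ 2 / r ^ 2 + L) * (u r ^ 2 + v r ^ 2) := by
      rw [pid r hr.1]; ring
    rw [e]
    simp only [Pi.add_apply, Pi.mul_apply]
    rw [eu r hr, ev r hr]
    ring
  have kc : ContinuousOn k (Set.Icc 0 1) := pc.continuousOn.mul ((uc.mul u1c).add (vc.mul v1c))
  have k0 : k 0 = 0 := by simp [hk, pw]
  have hkE : ∀ r ∈ Set.Ioo (0:ℝ) 1, k r = E r - β * M r := by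
    intro r hr
    have hsub : Set.Icc 0 r ⊆ Set.Icc (0:ℝ) 1 := Set.Icc_subset_Icc le_rfl hr.2.le
    have hd : ∀ x ∈ Set.Ioo 0 r, HasDerivAt (fun y => k y - (E y - β * M y)) 0 x := by
      intro x hx
      have hx' : x ∈ Set.Ioo (0:ℝ) 1 := ⟨hx.1, hx.2.trans hr.2⟩
      refine ((dk x hx').sub ((dE x hx').sub ((dM x hx').const_mul β))).congr_deriv ?_
      ring
    have cc : ContinuousOn (fun y => k y - (E y - β * M y)) (Set.Icc 0 r) :=
      (kc.mono hsub).sub (Ec.continuousOn.sub (continuousOn_const.mul Mc.continuousOn))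
    have h1 := mono_aux hr.1.le cc hd (fun x hx => le_rfl)
    have h2 := mono_aux hr.1.le cc.neg (fun x hx => (hd x hx).neg) (fun x hx => by simp)
    simp only [k0, E0, M0, Pi.neg_apply] at h1 h2
    linarith
  have dh : ∀ r ∈ Set.Ioo (0:ℝ) 1, HasDerivAt (fun r => u r ^ 2 + v r ^ 2) (2 * k r / pw n L r) r := by
    intro r hr
    refine (((du r hr).pow 2).add ((dv r hr).pow 2)).congr_deriv ?_
    have := hp r hr.1
    rw [hk]
    field_simp
    ring
  obtain ⟨σ, hσ, hσ2⟩ : ∃ σ : ℝ, σ * g = κ ∧ σ ^ 2 = 1 := by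
    rcases hg with h | h
    · exact ⟨1, by rw [h]; ring, by norm_num⟩
    · exact ⟨-1, by rw [h]; ring, by norm_num⟩
  set j : ℝ → ℝ := fun r => σ * (pw n L r * (u r * v1 r - v r * u1 r)) with hj
  have dj : ∀ r ∈ Set.Ioo (0:ℝ) 1, HasDerivAt j
      (κ * (μ - r ^ 2) * (pw n L r * (u r ^ 2 + v r ^ 2))) r := by
    intro r hr
    have := ((dp r hr.1).mul (((du r hr).mul (dv1 r hr)).sub ((dv r hr).mul (du1 r hr)))).const_mul σ
    refine HasDerivAt.congr_deriv (f := j) this ?_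
    simp only [Pi.sub_apply, Pi.mul_apply]
    rw [eu r hr, ev r hr, ← hσ]
    ring
  refine ⟨fun r => u1 r ^ 2 + v1 r ^ 2, k, j, M, E, ?_⟩
  exact
    { hn := hn, hL := hL, hκ := hκ
      h0 := fun r => by positivity
      w0 := fun r => by positivity
      hc := hc, Mc := Mc.continuousOn, Ec := Ec.continuousOn, M0 := M0, E0 := E0
      hz := by simp [u0, v0]
      hk := hkE, dM := dM, dE := dE, dh := dh, dj := dj
      hj := fun r hr => by
        have e : j r ^ 2 = σ ^ 2 * (pw n L r ^ 2 * (u r * v1 r - v r * u1 r) ^ 2) := by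
          rw [hj]; ring
        rw [e, hσ2, one_mul]
        gcongr
        nlinarith [sq_nonneg (u r * u1 r + v r * v1 r)]
      hkk := fun r hr => by
        have e : k r ^ 2 = pw n L r ^ 2 * (u r * u1 r + v r * v1 r) ^ 2 := by
          rw [hk]; ring
        rw [e]
        gcongr
        nlinarith [sq_nonneg (u r * v1 r - v r * u1 r)] }

/-- Localized bound `‖U‖²_{L²(0,s)} ≤ C s |U(s)|²/A(s)` for solutions of the
approximate elliptic equation (Proposition 5.2). -/
theorem approx_elliptic_local_bound :
    ∃ c₅ C : ℝ, c₅ ∈ Set.Ioo (0:ℝ) 1 ∧ 0 < C ∧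
      ∀ (n l : ℤ), n ≠ 0 → l ≠ 0 → ∀ ν : ℝ, 0 < ν → ν < c₅ * min |(l : ℝ)| 1 →
        ∀ lam : ℂ,
          (l : ℝ) * lam.im ≤ c₅ * |ν * (n : ℝ) * (l : ℝ)| ^ ((1:ℝ)/2) →
          ∀ U : ℝ → ℂ,
            ContDiffOn ℝ (⊤ : ℕ∞) U (Set.Icc 0 1) →
            (∀ r ∈ Set.Ioo (0:ℝ) 1,
              -(ν : ℂ) * hatD1 n l U r
                + Complex.I * (l : ℂ) * (lam - (r : ℂ) ^ 2) * U r = 0) →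
            U 0 = 0 → U 1 = 1 →
            ∀ s ∈ Set.Ioc (0:ℝ) 1,
              (∫ r in Set.Ioo (0:ℝ) s, ‖U r‖ ^ 2 * r)
                ≤ C * s * ‖U s‖ ^ 2
                  / (‖(l : ℂ) * (lam - (s : ℂ) ^ 2) / (ν : ℂ)‖ ^ ((1:ℝ)/2)
                      + |(l : ℝ) * s / ν| ^ ((1:ℝ)/3) + |(l : ℝ)| + |(n : ℝ) / s|) := by
  refine ⟨1 / 1156, 20400, by norm_num, by norm_num, ?_⟩
  intro n l hn hl ν hν _ lam hlam U hU hode hU0 _ s hs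
  obtain ⟨V, Vc, hVd, dU, dV, K, hK⟩ := reg hU
  have hn1 : (1:ℝ) ≤ |(n:ℝ)| := by exact_mod_cast Int.one_le_abs hn
  have hl1 : (1:ℝ) ≤ |(l:ℝ)| := by exact_mod_cast Int.one_le_abs hl
  set κ := |(l:ℝ)| / ν with hκd
  have hκ : 0 < κ := by positivity
  set β := (l:ℝ) * lam.im / ν with hβd
  have hν' : (ν:ℂ) ≠ 0 := by exact_mod_cast hν.ne'
  have ode2 : ∀ r ∈ Set.Ioo (0:ℝ) 1, deriv (deriv U) r =
      ((-1 / r + 2 * r * (l:ℝ) ^ 2 / (|(n:ℝ)| ^ 2 + r ^ 2 * (l:ℝ) ^ 2) : ℝ) : ℂ) * V r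
      + ((|(n:ℝ)| ^ 2 / r ^ 2 + (l:ℝ) ^ 2 - β : ℝ) : ℂ) * U r
      + Complex.I * (((l:ℝ) / ν * (lam.re - r ^ 2) : ℝ) : ℂ) * U r := by
    intro r hr
    have h := hode r hr
    unfold hatD1 at h
    rw [← hVd r hr] at h
    have hr0 : (r:ℂ) ≠ 0 := by exact_mod_cast hr.1.ne'
    have hlam2 : lam = (lam.re : ℂ) + lam.im * Complex.I := (Complex.re_add_im lam).symm
    have hden : ((n:ℂ) ^ 2 + (r:ℂ) ^ 2 * (l:ℂ) ^ 2) ≠ 0 := by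
      have : (n:ℝ) ^ 2 + r ^ 2 * (l:ℝ) ^ 2 ≠ 0 := by
        have : (n:ℝ) ≠ 0 := by exact_mod_cast hn
        positivity
      exact_mod_cast this
    have h2 : deriv (deriv U) r = - (V r / r) + ((n : ℂ) ^ 2 / (r : ℂ) ^ 2 + (l : ℂ) ^ 2) * U r
        + (2 * (r : ℂ) * (l : ℂ) ^ 2 / ((n : ℂ) ^ 2 + (r : ℂ) ^ 2 * (l : ℂ) ^ 2)) * V r
        + Complex.I * (l : ℂ) * (lam - (r : ℂ) ^ 2) / ν * U r := by
      apply mul_left_cancel₀ hν'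
      have e : (ν:ℂ) * (Complex.I * (l : ℂ) * (lam - (r : ℂ) ^ 2) / ν * U r)
        = Complex.I * (l : ℂ) * (lam - (r : ℂ) ^ 2) * U r := by field_simp
      rw [mul_add, e]
      linear_combination (-1 : ℂ) * h
    rw [h2, sq_abs, hβd]
    push_cast
    have e3 : Complex.I * (l : ℂ) * (lam - (r : ℂ) ^ 2) / ν
      = Complex.I * ((l:ℂ) / ν * (lam.re - (r:ℂ) ^ 2)) - (l:ℂ) * lam.im / ν := by
      have : (lam - (r:ℂ) ^ 2) = (lam.re - (r:ℂ) ^ 2) + lam.im * Complex.I := by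
        linear_combination hlam2
      rw [this]
      field_simp
      linear_combination (lam.im : ℂ) * Complex.I_sq
    rw [e3]
    ring
  have dre : ∀ {f : ℝ → ℂ} {f' : ℂ} {r : ℝ}, HasDerivAt f f' r →
      HasDerivAt (fun x => (f x).re) f'.re r := fun hf =>
    (Complex.reCLM.hasFDerivAt.comp_hasDerivAt _ hf)
  have dim : ∀ {f : ℝ → ℂ} {f' : ℂ} {r : ℝ}, HasDerivAt f f' r →
      HasDerivAt (fun x => (f x).im) f'.im r := fun hf =>
    (Complex.imCLM.hasFDerivAt.comp_hasDerivAt _ hf)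
  have hns : ∀ r, ‖U r‖ ^ 2 = (U r).re ^ 2 + (U r).im ^ 2 := fun r => by
    rw [Complex.sq_norm, Complex.normSq_apply]; ring
  obtain ⟨w, k, j, M, E, S⟩ := mkSys (n := |(n:ℝ)|) (l := (l:ℝ)) (κ := κ) (μ := lam.re) (β := β)
    (g := (l:ℝ) / ν) (u := fun r => (U r).re) (v := fun r => (U r).im)
    (u1 := fun r => (V r).re) (v1 := fun r => (V r).im)
    (u2 := fun r => (deriv (deriv U) r).re) (v2 := fun r => (deriv (deriv U) r).im) (K := K ^ 2)
    hn1 hκ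
    (by
      rw [hκd]
      rcases abs_choice (l:ℝ) with h | h
      · left; rw [h]
      · right; rw [h]; ring)
    (Complex.continuous_re.comp_continuousOn hU.continuousOn)
    (Complex.continuous_im.comp_continuousOn hU.continuousOn)
    (Complex.continuous_re.comp_continuousOn Vc)
    (Complex.continuous_im.comp_continuousOn Vc)
    (fun r hr => dre (dU r hr)) (fun r hr => dim (dU r hr))
    (fun r hr => dre (dV r hr)) (fun r hr => dim (dV r hr))
    (fun r hr => by
      rw [ode2 r hr]
      rw [Complex.add_re, Complex.add_re, Complex.re_ofReal_mul, Complex.re_ofReal_mul, mul_assoc Complex.I,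
        Complex.I_mul_re, Complex.im_ofReal_mul]
      ring)
    (fun r hr => by
      rw [ode2 r hr]
      rw [Complex.add_im, Complex.add_im, Complex.im_ofReal_mul, Complex.im_ofReal_mul, mul_assoc Complex.I,
        Complex.I_mul_im, Complex.re_ofReal_mul])
    (by simp [hU0]) (by simp [hU0])
    (fun r hr => by
      have h1 := hK r hr
      rw [hU0, sub_zero] at h1
      rw [← hns, ← mul_pow]
      gcongr)
  have hκn : 0 < κ * |(n:ℝ)| := by positivity
  set d := (κ * |(n:ℝ)|) ^ (-(1:ℝ)/4) with hdd
  have hd : 0 < d := by positivity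
  have hd4 : κ * |(n:ℝ)| * d ^ 4 = 1 := by
    rw [hdd, ← Real.rpow_natCast, ← Real.rpow_mul hκn.le]
    norm_num
    rw [Real.rpow_neg_one]
    field_simp
  have hd2 : d ^ 2 * (κ * |(n:ℝ)|) ^ ((1:ℝ)/2) = 1 := by
    rw [hdd, ← Real.rpow_natCast, ← Real.rpow_mul hκn.le, ← Real.rpow_add hκn]
    norm_num
  have hβ : β * d ^ 2 ≤ 1 / 1156 := by
    have e1 : |ν * (n : ℝ) * (l : ℝ)| = ν ^ 2 * (κ * |(n:ℝ)|) := by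
      rw [abs_mul, abs_mul, abs_of_pos hν, hκd]; field_simp
    have e2 : |ν * (n : ℝ) * (l : ℝ)| ^ ((1:ℝ)/2) = ν * (κ * |(n:ℝ)|) ^ ((1:ℝ)/2) := by
      rw [e1, Real.mul_rpow (by positivity) hκn.le, ← Real.rpow_natCast, ← Real.rpow_mul hν.le]
      norm_num
    rw [e2] at hlam
    have h1 : β ≤ 1 / 1156 * (κ * |(n:ℝ)|) ^ ((1:ℝ)/2) := by
      rw [hβd, div_le_iff₀ hν]; linarith
    calc β * d ^ 2 ≤ 1 / 1156 * (κ * |(n:ℝ)|) ^ ((1:ℝ)/2) * d ^ 2 := by gcongr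
      _ = 1 / 1156 * (d ^ 2 * (κ * |(n:ℝ)|) ^ ((1:ℝ)/2)) := by ring
      _ = 1 / 1156 := by rw [hd2, mul_one]
  have hs0 := hs.1
  have hs1 := hs.2
  have hfin := S.final hd hd4 hβ hs0 hs1
  obtain ⟨I, Ic, I0, dI, hI⟩ := exists_prim (f := fun r => ((U r).re ^ 2 + (U r).im ^ 2) * r)
    (S.hc.mul continuousOn_id)
  have hwt := weight_bound S hd hd4 hβ hs0 hs1 Ic I0 dI
  have hint : (∫ r in Set.Ioo (0:ℝ) s, ‖U r‖ ^ 2 * r) = I s := by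
    rw [← hI s hs]
    simp only [hns]
  rw [hint, hns s]
  set H := (U s).re ^ 2 + (U s).im ^ 2 with hH
  set A' := Real.sqrt (κ * |lam.re - s ^ 2|) + Real.sqrt |β| + (κ * s) ^ ((1:ℝ)/3)
      + Real.sqrt ((l:ℝ) ^ 2) + |(n:ℝ)| / s with hA'
  have hP : 0 < pw |(n:ℝ)| ((l:ℝ) ^ 2) s := S.p_pos hs0
  set P := pw |(n:ℝ)| ((l:ℝ) ^ 2) s with hPd
  have hA : ‖(l : ℂ) * (lam - (s : ℂ) ^ 2) / (ν : ℂ)‖ ^ ((1:ℝ)/2)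
      + |(l : ℝ) * s / ν| ^ ((1:ℝ)/3) + |(l : ℝ)| + |(n : ℝ) / s| ≤ A' := by
    have b1 : ‖(l : ℂ) * (lam - (s : ℂ) ^ 2) / (ν : ℂ)‖ ≤ κ * |lam.re - s ^ 2| + |β| := by
      have : ‖lam - (s:ℂ) ^ 2‖ ≤ |lam.re - s ^ 2| + |lam.im| := by
        have := Complex.norm_le_abs_re_add_abs_im (lam - (s:ℂ) ^ 2)
        rw [← Complex.ofReal_pow, Complex.sub_re, Complex.sub_im, Complex.ofReal_re,
          Complex.ofReal_im, sub_zero] at this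
        rwa [← Complex.ofReal_pow]
      rw [norm_div, norm_mul, Complex.norm_intCast, Complex.norm_real, Real.norm_of_nonneg hν.le,
        hβd, abs_div, abs_mul, abs_of_pos hν, hκd]
      calc |(l:ℝ)| * ‖lam - (s:ℂ) ^ 2‖ / ν ≤ |(l:ℝ)| * (|lam.re - s ^ 2| + |lam.im|) / ν := by gcongr
        _ = _ := by ring
    have b2 : ‖(l : ℂ) * (lam - (s : ℂ) ^ 2) / (ν : ℂ)‖ ^ ((1:ℝ)/2)
        ≤ Real.sqrt (κ * |lam.re - s ^ 2|) + Real.sqrt |β| := by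
      rw [← Real.sqrt_eq_rpow]
      refine (Real.sqrt_le_sqrt b1).trans ?_
      rw [Real.sqrt_le_iff]
      have q1 := Real.sq_sqrt (show 0 ≤ κ * |lam.re - s ^ 2| by positivity)
      have q2 := Real.sq_sqrt (abs_nonneg β)
      have q3 := Real.sqrt_nonneg (κ * |lam.re - s ^ 2|)
      have q4 := Real.sqrt_nonneg |β|
      exact ⟨by positivity, by nlinarith⟩
    have b3 : |(l : ℝ) * s / ν| = κ * s := by
      rw [abs_div, abs_mul, abs_of_pos hν, abs_of_pos hs0, hκd]; ring
    have b4 : |(n : ℝ) / s| = |(n:ℝ)| / s := by rw [abs_div, abs_of_pos hs0]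
    rw [b3, b4, hA', Real.sqrt_sq_eq_abs]
    linarith
  have hApos : 0 < ‖(l : ℂ) * (lam - (s : ℂ) ^ 2) / (ν : ℂ)‖ ^ ((1:ℝ)/2)
      + |(l : ℝ) * s / ν| ^ ((1:ℝ)/3) + |(l : ℝ)| + |(n : ℝ) / s| := by
    have : 0 < |(l:ℝ)| := by linarith
    positivity
  rw [le_div_iff₀ hApos]
  have hI0 : 0 ≤ I s := by
    rw [← I0]
    exact mono_aux hs0.le Ic.continuousOn (fun x hx => dI x ⟨hx.1, by linarith [hx.2]⟩)
      (fun x hx => by have := hx.1; positivity)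
  have hA'0 : 0 ≤ A' := hApos.le.trans hA
  have c1 : I s * P * A' ≤ 2 * s * (M s - M (s / 2)) * A' := by gcongr
  have c2 : 2 * s * ((M s - M (s / 2)) * A') ≤ 2 * s * (10200 * (P * H)) := by gcongr
  have c3 : (I s * A') * P ≤ (20400 * s * H) * P := by linarith
  have c4 := le_of_mul_le_mul_right c3 hP
  exact (mul_le_mul_of_nonneg_left hA hI0).trans c4
end

section
/- There is a universal constant C > 0 such that for all nonzero integers n, l, all ν > 0, all s ∈ (0,1], and all λ̃ ∈ ℂ satisfying l·Im λ̃ ≤ max(|l(λ̃−s²)|/2, ν(n²/s² + l²)/3) and |ν/(sl)|^{1/3}·A₁(s) ≥ 1, where A₁(s) = |l(λ̃−s²)/ν|^{1/2} + |l| + |n/s|: every smooth U : [0,s] → ℂ with U(0) = 0 and U(s) = 1 solving −ν·Δ̂₁U + i·l·(λ̃−s²)·U = 0 on (0,s) satisfies ∫₀^s |U(r)|² r dr ≤ C·(A₁(s)/s)^{−1} and ∫₀^s |(s²−r²)U(r)|² r dr ≤ C·(A₁(s)/s)^{−3}. -/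
open MeasureTheory

lemma hee_coercive (X M q : ℝ) (κ : ℂ) (hX : 0 ≤ X) (hM : 0 ≤ M) (hq : q * M ≤ X)
    (hκ : -κ.re ≤ max (‖κ‖ / 2) (q / 3)) :
    X + ‖κ‖ * M ≤ 5 / 2 * ‖(X : ℂ) + κ * (M : ℂ)‖ := by
  have hk := norm_nonneg κ
  have hsq : ‖(X : ℂ) + κ * (M : ℂ)‖ ^ 2 = X ^ 2 + 2 * κ.re * X * M + ‖κ‖ ^ 2 * M ^ 2 := by
    rw [← Complex.normSq_eq_norm_sq, ← Complex.normSq_eq_norm_sq, Complex.normSq_apply,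
      Complex.normSq_apply]
    simp
    ring
  have hXM := mul_nonneg hX hM
  by_cases h1 : -κ.re ≤ ‖κ‖ / 2
  · refine abs_le_of_sq_le_sq' ?_ (by positivity) |>.2
    rw [mul_pow, hsq]
    nlinarith [sq_nonneg (X - ‖κ‖ * M), mul_le_mul_of_nonneg_right h1 hXM,
      mul_nonneg hk hXM, sq_nonneg (X + ‖κ‖ * M)]
  · have h2 : -κ.re ≤ q / 3 := by
      rcases le_max_iff.1 hκ with h | h
      · exact absurd h h1
      · exact h
    have h3 : X + κ.re * M ≤ ‖(X : ℂ) + κ * (M : ℂ)‖ := by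
      have := Complex.re_le_norm ((X : ℂ) + κ * (M : ℂ))
      simpa using this
    push Not at h1
    have h4 : ‖κ‖ ≤ 2 / 3 * q := by linarith
    nlinarith [mul_le_mul_of_nonneg_right h2 hM, mul_le_mul_of_nonneg_right h4 hM]

lemma hee_ibp (s : ℝ) (hs : 0 < s) (F F' Φ Φ' : ℝ → ℂ)
    (hF : ContinuousOn F (Set.Icc 0 s)) (hF' : ContinuousOn F' (Set.Icc 0 s))
    (hΦ : ContinuousOn Φ (Set.Icc 0 s)) (hΦ' : ContinuousOn Φ' (Set.Icc 0 s))
    (dF : ∀ r ∈ Set.Ioo 0 s, HasDerivAt F (F' r) r)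
    (dΦ : ∀ r ∈ Set.Ioo 0 s, HasDerivAt Φ (Φ' r) r) (h0 : F 0 = 0) :
    ∫ r in (0:ℝ)..s, (F' r * Φ r + F r * Φ' r) = F s * Φ s := by
  rw [intervalIntegral.integral_eq_sub_of_hasDerivAt_of_le (f := fun r => F r * Φ r) hs.le
    (hF.mul hΦ) (fun r hr => (dF r hr).mul (dΦ r hr))
    (((hF'.mul hΦ).add (hF.mul hΦ')).intervalIntegrable_of_Icc hs.le)]
  simp [h0]

/-- the weight -/
noncomputable def heep (N L r : ℝ) : ℝ := r / (N + r ^ 2 * L)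

lemma heep_cont (N L : ℝ) (hN : 1 ≤ N) (hL : 0 ≤ L) : Continuous (heep N L) := by
  unfold heep
  refine continuous_id.div (by fun_prop) (fun r => ?_)
  positivity

lemma hee_weighted (s N L : ℝ) (hs : 0 < s) (hN : 1 ≤ N) (hL : 0 ≤ L) (κ : ℂ)
    (hκ : -κ.re ≤ max (‖κ‖ / 2) ((N / s ^ 2 + L) / 3))
    (U D H : ℝ → ℂ)
    (cU : ContinuousOn U (Set.Icc 0 s)) (cD : ContinuousOn D (Set.Icc 0 s))
    (cH : ContinuousOn H (Set.Icc 0 s))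
    (dU : ∀ r ∈ Set.Ioo 0 s, HasDerivAt U (D r) r)
    (dF : ∀ r ∈ Set.Ioo 0 s, HasDerivAt (fun r => (heep N L r : ℂ) * D r)
      (H r + κ * heep N L r * U r) r)
    (hH : ∀ r ∈ Set.Ioo 0 s, H r = U r / r)
    (ρ ρ' : ℝ → ℝ) (cρ : Continuous ρ) (cρ' : Continuous ρ')
    (dρ : ∀ r, HasDerivAt ρ (ρ' r) r) (ρ0 : ∀ r, 0 ≤ ρ r) :
    (∫ r in (0:ℝ)..s, ρ r * (heep N L r * ‖D r‖ ^ 2 + ‖H r‖ * ‖U r‖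
        + ‖κ‖ * heep N L r * ‖U r‖ ^ 2)) ≤
      5 / 2 * ‖(heep N L s : ℂ) * D s * (ρ s * (starRingEnd ℂ) (U s))
        - ∫ r in (0:ℝ)..s, (heep N L r : ℂ) * D r * (ρ' r * (starRingEnd ℂ) (U r))‖ := by
  have cp := heep_cont N L hN hL
  have cpO : ContinuousOn (heep N L) (Set.Icc 0 s) := cp.continuousOn
  have cρO : ContinuousOn ρ (Set.Icc 0 s) := cρ.continuousOn
  have cρO' : ContinuousOn ρ' (Set.Icc 0 s) := cρ'.continuousOn
  have cpC : ContinuousOn (fun r => (heep N L r : ℂ)) (Set.Icc 0 s) :=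
    (Complex.continuous_ofReal.comp cp).continuousOn
  have cρC : ContinuousOn (fun r => (ρ r : ℂ)) (Set.Icc 0 s) :=
    (Complex.continuous_ofReal.comp cρ).continuousOn
  have cρC' : ContinuousOn (fun r => (ρ' r : ℂ)) (Set.Icc 0 s) :=
    (Complex.continuous_ofReal.comp cρ').continuousOn
  have cUs : ContinuousOn (fun r => (starRingEnd ℂ) (U r)) (Set.Icc 0 s) :=
    Complex.continuous_conj.comp_continuousOn cU
  have cDs : ContinuousOn (fun r => (starRingEnd ℂ) (D r)) (Set.Icc 0 s) :=
    Complex.continuous_conj.comp_continuousOn cD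
  set X := ∫ r in (0:ℝ)..s, ρ r * (heep N L r * ‖D r‖ ^ 2 + ‖H r‖ * ‖U r‖) with hX
  set M := ∫ r in (0:ℝ)..s, ρ r * (heep N L r * ‖U r‖ ^ 2) with hM
  have cX : ContinuousOn (fun r => ρ r * (heep N L r * ‖D r‖ ^ 2 + ‖H r‖ * ‖U r‖))
    (Set.Icc 0 s) := by fun_prop
  have cM : ContinuousOn (fun r => ρ r * (heep N L r * ‖U r‖ ^ 2))
    (Set.Icc 0 s) := by fun_prop
  have iX := cX.intervalIntegrable_of_Icc (μ := volume) hs.le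
  have iM := cM.intervalIntegrable_of_Icc (μ := volume) hs.le
  have p0 : ∀ r, 0 ≤ r → 0 ≤ heep N L r := fun r hr => by unfold heep; positivity
  have hX0 : 0 ≤ X := intervalIntegral.integral_nonneg hs.le (fun r hr => by
    have := p0 r hr.1
    have := ρ0 r
    positivity)
  have hM0 : 0 ≤ M := intervalIntegral.integral_nonneg hs.le (fun r hr => by
    have := p0 r hr.1
    have := ρ0 r
    positivity)
  have hqM : (N / s ^ 2 + L) * M ≤ X := by
    rw [hM, ← intervalIntegral.integral_const_mul]
    refine intervalIntegral.integral_mono_on_of_le_Ioo hs.le (iM.const_mul _) iX (fun r hr => ?_)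
    have hr0 : 0 < r := hr.1
    have hrs : r < s := hr.2
    have hρ := ρ0 r
    have key : (N / s ^ 2 + L) * heep N L r ≤ 1 / r := by
      unfold heep
      rw [mul_div_assoc', div_le_div_iff₀ (by positivity) hr0, ]
      have : N / s ^ 2 * r ^ 2 ≤ N := by
        rw [div_mul_eq_mul_div, div_le_iff₀ (by positivity)]
        gcongr
      nlinarith
    have hHU : ‖H r‖ * ‖U r‖ = 1 / r * ‖U r‖ ^ 2 := by
      rw [hH r hr, norm_div, Complex.norm_real, Real.norm_of_nonneg hr0.le]; ring
    rw [hHU]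
    have h1 := mul_le_mul_of_nonneg_right key (sq_nonneg ‖U r‖)
    have h2 : 0 ≤ heep N L r * ‖D r‖ ^ 2 := mul_nonneg (p0 r hr0.le) (sq_nonneg _)
    calc _ = ρ r * ((N / s ^ 2 + L) * heep N L r * ‖U r‖ ^ 2) := by ring
      _ ≤ _ := by
        apply mul_le_mul_of_nonneg_left _ hρ
        linarith
  have hco := hee_coercive X M _ κ hX0 hM0 hqM hκ
  have hL1 : (∫ r in (0:ℝ)..s, ρ r * (heep N L r * ‖D r‖ ^ 2 + ‖H r‖ * ‖U r‖
        + ‖κ‖ * heep N L r * ‖U r‖ ^ 2)) = X + ‖κ‖ * M := by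
    rw [hX, hM, ← intervalIntegral.integral_const_mul,
      ← intervalIntegral.integral_add iX (iM.const_mul _)]
    congr 1; ext r; ring
  rw [hL1]
  have hI := hee_ibp s hs (fun r => (heep N L r : ℂ) * D r)
    (fun r => H r + κ * heep N L r * U r) (fun r => ρ r * (starRingEnd ℂ) (U r))
    (fun r => ρ' r * (starRingEnd ℂ) (U r) + ρ r * (starRingEnd ℂ) (D r))
    (by fun_prop) (by fun_prop) (by fun_prop) (by fun_prop) dF
    (fun r hr => (dρ r).ofReal_comp.mul ((dU r hr).star)) (by simp [heep])
  have hE : (X : ℂ) + κ * M = (heep N L s : ℂ) * D s * (ρ s * (starRingEnd ℂ) (U s))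
        - ∫ r in (0:ℝ)..s, (heep N L r : ℂ) * D r * (ρ' r * (starRingEnd ℂ) (U r)) := by
    rw [← hI, ← intervalIntegral.integral_sub
      (ContinuousOn.intervalIntegrable_of_Icc hs.le (by fun_prop))
      (ContinuousOn.intervalIntegrable_of_Icc hs.le (by fun_prop)), hX, hM,
      ← intervalIntegral.integral_ofReal, ← intervalIntegral.integral_ofReal,
      ← intervalIntegral.integral_const_mul, ← intervalIntegral.integral_add
      (ContinuousOn.intervalIntegrable_of_Icc hs.le (by fun_prop))
      (ContinuousOn.intervalIntegrable_of_Icc hs.le (by fun_prop))]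
    refine intervalIntegral.integral_congr_Ioo_of_le hs.le (fun r hr => ?_)
    have hr0 : 0 < r := hr.1
    have hHU : ‖H r‖ * ‖U r‖ = 1 / r * ‖U r‖ ^ 2 := by
      rw [hH r hr, norm_div, Complex.norm_real, Real.norm_of_nonneg hr0.le]; ring
    have e1 := Complex.mul_conj' (U r)
    have e2 := Complex.mul_conj' (D r)
    simp only [hHU]
    simp only [hH r hr]
    push_cast
    rw [← e1, ← e2]
    ring
  rw [← hE]
  exact hco

lemma hee_p_le (s N L r : ℝ) (hs : 0 < s) (hN : 1 ≤ N) (hL : 0 ≤ L) (hr0 : 0 < r) (hrs : r < s) :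
    heep N L r ≤ 1 / (r * (N / s ^ 2 + L)) := by
  unfold heep
  rw [div_le_div_iff₀ (by positivity) (by positivity)]
  have : N / s ^ 2 * r ^ 2 ≤ N := by
    rw [div_mul_eq_mul_div, div_le_iff₀ (by positivity)]
    gcongr
  nlinarith

lemma hee_mass (s N L K : ℝ) (hs : 0 < s) (hN : 1 ≤ N) (hL : 0 ≤ L) (hK : 0 ≤ K)
    (U D H : ℝ → ℂ)
    (cU : ContinuousOn U (Set.Icc 0 s)) (cD : ContinuousOn D (Set.Icc 0 s))
    (cH : ContinuousOn H (Set.Icc 0 s))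
    (hH : ∀ r ∈ Set.Ioo 0 s, H r = U r / r)
    (ρ : ℝ → ℝ) (cρ : Continuous ρ) (ρ0 : ∀ r, 0 ≤ ρ r) :
    (N / s ^ 2 + L + K) * (∫ r in (0:ℝ)..s, ρ r * (‖U r‖ ^ 2 * r)) ≤
    s ^ 2 * (N / s ^ 2 + L) * (∫ r in (0:ℝ)..s, ρ r * (heep N L r * ‖D r‖ ^ 2 + ‖H r‖ * ‖U r‖
        + K * heep N L r * ‖U r‖ ^ 2)) := by
  have cp := heep_cont N L hN hL
  have cpO : ContinuousOn (heep N L) (Set.Icc 0 s) := cp.continuousOn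
  have cρO : ContinuousOn ρ (Set.Icc 0 s) := cρ.continuousOn
  rw [← intervalIntegral.integral_const_mul, ← intervalIntegral.integral_const_mul]
  refine intervalIntegral.integral_mono_on_of_le_Ioo hs.le
    (ContinuousOn.intervalIntegrable_of_Icc hs.le (by fun_prop))
    (ContinuousOn.intervalIntegrable_of_Icc hs.le (by fun_prop)) (fun r hr => ?_)
  have hr0 : 0 < r := hr.1
  have hrs : r < s := hr.2
  have hρ := ρ0 r
  have p0 : 0 ≤ heep N L r := by unfold heep; positivity
  have hHU : ‖H r‖ * ‖U r‖ = 1 / r * ‖U r‖ ^ 2 := by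
    rw [hH r hr, norm_div, Complex.norm_real, Real.norm_of_nonneg hr0.le]; ring
  rw [hHU]
  have hr2 : r ^ 2 ≤ s ^ 2 := by gcongr
  have k1 : (N / s ^ 2 + L) * r ≤ s ^ 2 * (N / s ^ 2 + L) * (1 / r) := by
    rw [mul_one_div, le_div_iff₀ hr0]
    have : 0 ≤ N / s ^ 2 + L := by positivity
    nlinarith
  have k2 : r ≤ s ^ 2 * (N / s ^ 2 + L) * heep N L r := by
    have : s ^ 2 * (N / s ^ 2 + L) = N + s ^ 2 * L := by field_simp
    rw [this]
    unfold heep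
    rw [mul_div_assoc', le_div_iff₀ (by positivity)]
    nlinarith [mul_le_mul_of_nonneg_right hr2 (mul_nonneg hr0.le hL)]
  have k3 : 0 ≤ s ^ 2 * (N / s ^ 2 + L) * (heep N L r * ‖D r‖ ^ 2) := by positivity
  have u0 := sq_nonneg ‖U r‖
  calc _ = ρ r * (((N / s ^ 2 + L) * r) * ‖U r‖ ^ 2 + K * (r * ‖U r‖ ^ 2)) := by ring
    _ ≤ ρ r * ((s ^ 2 * (N / s ^ 2 + L) * (1 / r)) * ‖U r‖ ^ 2
          + K * ((s ^ 2 * (N / s ^ 2 + L) * heep N L r) * ‖U r‖ ^ 2)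
          + s ^ 2 * (N / s ^ 2 + L) * (heep N L r * ‖D r‖ ^ 2)) := by
        apply mul_le_mul_of_nonneg_left _ hρ
        have a1 := mul_le_mul_of_nonneg_right k1 u0
        have a2 := mul_le_mul_of_nonneg_left (mul_le_mul_of_nonneg_right k2 u0) hK
        linarith
    _ = _ := by ring

lemma hee_flux (s N L A : ℝ) (hs : 0 < s) (hN : 1 ≤ N) (hL : 0 ≤ L) (κ : ℂ)
    (hA : 1 ≤ A * s) (hAq : N / s ^ 2 + L ≤ A ^ 2) (hAκ : ‖κ‖ ≤ A ^ 2)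
    (U D H : ℝ → ℂ)
    (cU : ContinuousOn U (Set.Icc 0 s)) (cD : ContinuousOn D (Set.Icc 0 s))
    (cH : ContinuousOn H (Set.Icc 0 s))
    (dF : ∀ r ∈ Set.Ioo 0 s, HasDerivAt (fun r => (heep N L r : ℂ) * D r)
      (H r + κ * heep N L r * U r) r)
    (hH : ∀ r ∈ Set.Ioo 0 s, H r = U r / r) :
    ‖(heep N L s : ℂ) * D s‖ ≤
    1 / 5 * (∫ r in (0:ℝ)..s, (heep N L r * ‖D r‖ ^ 2 + ‖H r‖ * ‖U r‖
        + ‖κ‖ * heep N L r * ‖U r‖ ^ 2)) + 5 * (A / (s * (N / s ^ 2 + L))) := by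
  have cp := heep_cont N L hN hL
  have cpO : ContinuousOn (heep N L) (Set.Icc 0 s) := cp.continuousOn
  have cpC : ContinuousOn (fun r => (heep N L r : ℂ)) (Set.Icc 0 s) :=
    (Complex.continuous_ofReal.comp cp).continuousOn
  set q := N / s ^ 2 + L with hqdef
  have hq : 0 < q := by positivity
  have hA0 : 0 < A := by
    by_contra h
    push Not at h
    nlinarith
  have hK := norm_nonneg κ
  set K := ‖κ‖ with hKdef
  obtain ⟨k, hk1, hk2⟩ : ∃ k : ℕ, A * s ≤ (k : ℝ) + 2 ∧ (k : ℝ) + 2 ≤ 3 * (A * s) := by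
    refine ⟨⌊A * s⌋₊, ?_, ?_⟩
    · have := Nat.lt_floor_add_one (A * s); linarith
    · have := Nat.floor_le (by positivity : 0 ≤ A * s); linarith
  set V : ℝ → ℝ := fun r => r ^ (k + 2) / s ^ (k + 2) with hV
  set V' : ℝ → ℝ := fun r => (k + 2) * r ^ (k + 1) / s ^ (k + 2) with hV'
  have cV : Continuous V := by fun_prop
  have cV' : Continuous V' := by fun_prop
  have cVC : ContinuousOn (fun r => (V r : ℂ)) (Set.Icc 0 s) :=
    (Complex.continuous_ofReal.comp cV).continuousOn
  have cVC' : ContinuousOn (fun r => (V' r : ℂ)) (Set.Icc 0 s) :=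
    (Complex.continuous_ofReal.comp cV').continuousOn
  have dV : ∀ r, HasDerivAt V (V' r) r := fun r => by
    have := (hasDerivAt_pow (k + 2) r).div_const (s ^ (k + 2))
    simpa [hV, hV'] using this
  have hI := hee_ibp s hs (fun r => (heep N L r : ℂ) * D r)
    (fun r => H r + κ * heep N L r * U r) (fun r => V r) (fun r => V' r)
    (by fun_prop) (by fun_prop) (by fun_prop) (by fun_prop) dF
    (fun r hr => (dV r).ofReal_comp) (by simp [heep])
  have hVs : V s = 1 := by simp only [hV]; exact div_self (by positivity)
  simp only [hVs, Complex.ofReal_one, mul_one] at hI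
  rw [← hI]
  set vb : ℝ → ℝ := fun r => ((k + 2) ^ 2 / (q * s ^ (2 * k + 4))) * r ^ (2 * k + 1)
    + ((1 + K / q) / s ^ (2 * k + 4)) * r ^ (2 * k + 3) with hvb
  have cvb : Continuous vb := by fun_prop
  have ivb : ∫ r in (0:ℝ)..s, vb r ≤ 4 * (A / (s * q)) := by
    have e : ∫ r in (0:ℝ)..s, vb r = (k + 2) ^ 2 / ((2 * k + 2) * (q * s ^ 2))
        + (1 + K / q) / (2 * k + 4) := by
      simp only [hvb]
      rw [intervalIntegral.integral_add
        (Continuous.intervalIntegrable (by fun_prop) _ _)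
        (Continuous.intervalIntegrable (by fun_prop) _ _),
        intervalIntegral.integral_const_mul, intervalIntegral.integral_const_mul,
        integral_pow, integral_pow]
      push_cast
      have : (s:ℝ) ^ (2 * k + 4) = s ^ (2 * k + 1 + 1) * s ^ 2 := by ring
      rw [this]
      have h3 : (0:ℝ) < s ^ (2 * k + 1 + 1) := by positivity
      set S := s ^ (2 * k + 1 + 1)
      simp only [zero_pow (Nat.succ_ne_zero _), sub_zero]
      field_simp
      ring
    rw [e]
    have hk0 : (0:ℝ) ≤ k := Nat.cast_nonneg k
    have b1 : ((k:ℝ) + 2) ^ 2 / ((2 * k + 2) * (q * s ^ 2)) ≤ 3 * (A / (s * q)) := by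
      have : ((k:ℝ) + 2) ^ 2 / ((2 * k + 2) * (q * s ^ 2)) ≤ (k + 2) / (q * s ^ 2) := by
        rw [div_le_div_iff₀ (by positivity) (by positivity)]
        have : 0 < q * s ^ 2 := by positivity
        have h : ((k:ℝ) + 2) ^ 2 ≤ (k + 2) * (2 * k + 2) := by nlinarith
        nlinarith [mul_le_mul_of_nonneg_right h this.le]
      refine this.trans ?_
      have e3 : 3 * (A / (s * q)) = 3 * (A * s) / (q * s ^ 2) := by field_simp
      rw [e3]
      gcongr
    have b2 : (1 + K / q) / (2 * k + 4) ≤ A / (s * q) := by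
      have : 1 + K / q ≤ 2 * A ^ 2 / q := by
        rw [le_div_iff₀ hq, add_mul, div_mul_cancel₀ _ hq.ne']; linarith
      calc _ ≤ (2 * A ^ 2 / q) / (2 * (A * s)) := by
            gcongr
            linarith
        _ = _ := by field_simp
    linarith
  calc _ ≤ ∫ r in (0:ℝ)..s, ‖(H r + κ * heep N L r * U r) * (V r : ℂ)
          + (heep N L r : ℂ) * D r * (V' r : ℂ)‖ :=
        intervalIntegral.norm_integral_le_integral_norm hs.le
    _ ≤ ∫ r in (0:ℝ)..s, (1 / 5 * (heep N L r * ‖D r‖ ^ 2 + ‖H r‖ * ‖U r‖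
        + K * heep N L r * ‖U r‖ ^ 2) + 5 / 4 * vb r) := by
      refine intervalIntegral.integral_mono_on_of_le_Ioo hs.le
        (ContinuousOn.intervalIntegrable_of_Icc hs.le (by fun_prop))
        (ContinuousOn.intervalIntegrable_of_Icc hs.le ?_) (fun r hr => ?_)
      · have := cvb.continuousOn (s := Set.Icc 0 s)
        fun_prop
      have hr0 : 0 < r := hr.1
      have hrs : r < s := hr.2
      have p0 : 0 ≤ heep N L r := by unfold heep; positivity
      have ple := hee_p_le s N L r hs hN hL hr0 hrs
      rw [← hqdef] at ple
      have nH : ‖H r‖ = ‖U r‖ / r := by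
        rw [hH r hr, norm_div, Complex.norm_real, Real.norm_of_nonneg hr0.le]
      have V0 : 0 ≤ V r := by simp only [hV]; positivity
      have V0' : 0 ≤ V' r := by simp only [hV']; positivity
      have hvle : heep N L r * V' r ^ 2 + 1 / r * V r ^ 2 + K * heep N L r * V r ^ 2 ≤ vb r := by
        have t1 : heep N L r * V' r ^ 2 ≤ 1 / (r * q) * V' r ^ 2 := by gcongr
        have t2 : K * heep N L r * V r ^ 2 ≤ K * (1 / (r * q)) * V r ^ 2 := by gcongr
        have t3 : 1 / (r * q) * V' r ^ 2 + 1 / r * V r ^ 2 + K * (1 / (r * q)) * V r ^ 2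
            = vb r := by
          simp only [hV, hV', hvb]
          field_simp
          ring
        linarith
      have h1 : ‖(H r + κ * heep N L r * U r) * (V r : ℂ)
          + (heep N L r : ℂ) * D r * (V' r : ℂ)‖ ≤
          (‖U r‖ / r + K * heep N L r * ‖U r‖) * V r + heep N L r * ‖D r‖ * V' r := by
        refine (norm_add_le _ _).trans ?_
        simp only [norm_mul, Complex.norm_real, Real.norm_of_nonneg p0, Real.norm_of_nonneg V0,
          Real.norm_of_nonneg V0']
        gcongr
        refine (norm_add_le _ _).trans ?_
        simp only [norm_mul, Complex.norm_real, Real.norm_of_nonneg p0, nH]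
        exact le_rfl
      refine h1.trans ?_
      rw [nH]
      have amgm : ∀ x y : ℝ, x * y ≤ 1 / 5 * x ^ 2 + 5 / 4 * y ^ 2 := fun x y => by
        nlinarith [sq_nonneg (2 * x - 5 * y)]
      have g1 := mul_le_mul_of_nonneg_left (amgm ‖U r‖ (V r)) (one_div_nonneg.2 hr0.le)
      have g2 := mul_le_mul_of_nonneg_left (amgm ‖U r‖ (V r)) (mul_nonneg hK p0)
      have g3 := mul_le_mul_of_nonneg_left (amgm ‖D r‖ (V' r)) p0
      have e1 : ‖U r‖ / r = 1 / r * ‖U r‖ := by ring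
      rw [e1]
      linarith
    _ = 1 / 5 * (∫ r in (0:ℝ)..s, (heep N L r * ‖D r‖ ^ 2 + ‖H r‖ * ‖U r‖
        + K * heep N L r * ‖U r‖ ^ 2)) + 5 / 4 * ∫ r in (0:ℝ)..s, vb r := by
      rw [intervalIntegral.integral_add, intervalIntegral.integral_const_mul,
        intervalIntegral.integral_const_mul]
      · exact ContinuousOn.intervalIntegrable_of_Icc hs.le (by fun_prop)
      · exact Continuous.intervalIntegrable (by fun_prop) _ _
    _ ≤ _ := by linarith

lemma hee_core (s N L A : ℝ) (hs : 0 < s) (hN : 1 ≤ N) (hL : 0 ≤ L) (κ : ℂ)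
    (hκ : -κ.re ≤ max (‖κ‖ / 2) ((N / s ^ 2 + L) / 3))
    (hA : 1 ≤ A * s) (hAq : N / s ^ 2 + L ≤ A ^ 2) (hAκ : ‖κ‖ ≤ A ^ 2)
    (hA3 : A ^ 2 ≤ 3 * (N / s ^ 2 + L + ‖κ‖))
    (U D H : ℝ → ℂ)
    (cU : ContinuousOn U (Set.Icc 0 s)) (cD : ContinuousOn D (Set.Icc 0 s))
    (cH : ContinuousOn H (Set.Icc 0 s))
    (dU : ∀ r ∈ Set.Ioo 0 s, HasDerivAt U (D r) r)
    (dF : ∀ r ∈ Set.Ioo 0 s, HasDerivAt (fun r => (heep N L r : ℂ) * D r)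
      (H r + κ * heep N L r * U r) r)
    (hH : ∀ r ∈ Set.Ioo 0 s, H r = U r / r) (hUs : U s = 1) :
    (∫ r in (0:ℝ)..s, ‖U r‖ ^ 2 * r) ≤ 75 * (s / A) ∧
    (∫ r in (0:ℝ)..s, (s ^ 2 - r ^ 2) ^ 2 * (‖U r‖ ^ 2 * r)) ≤ 22500 * (s / A) ^ 3 := by
  have cp := heep_cont N L hN hL
  have cpO : ContinuousOn (heep N L) (Set.Icc 0 s) := cp.continuousOn
  have cpC : ContinuousOn (fun r => (heep N L r : ℂ)) (Set.Icc 0 s) :=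
    (Complex.continuous_ofReal.comp cp).continuousOn
  have cUs : ContinuousOn (fun r => (starRingEnd ℂ) (U r)) (Set.Icc 0 s) :=
    Complex.continuous_conj.comp_continuousOn cU
  have hA0 : 0 < A := by
    by_contra h
    push Not at h
    nlinarith
  have w1 := hee_weighted s N L hs hN hL κ hκ U D H cU cD cH dU dF hH (fun _ => 1) (fun _ => 0)
    continuous_const continuous_const (fun r => hasDerivAt_const r 1) (fun _ => zero_le_one)
  have w2 := hee_weighted s N L hs hN hL κ hκ U D H cU cD cH dU dF hH
    (fun r => (s ^ 2 - r ^ 2) ^ 2) (fun r => -4 * r * (s ^ 2 - r ^ 2))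
    (by fun_prop) (by fun_prop) (fun r => by
      have := (((hasDerivAt_pow 2 r).const_sub (s ^ 2)).pow 2)
      refine HasDerivAt.congr_deriv this ?_
      push_cast
      ring) (fun _ => by positivity)
  have m1 := hee_mass s N L ‖κ‖ hs hN hL (norm_nonneg _) U D H cU cD cH hH (fun _ => 1)
    continuous_const (fun _ => zero_le_one)
  have m2 := hee_mass s N L ‖κ‖ hs hN hL (norm_nonneg _) U D H cU cD cH hH
    (fun r => (s ^ 2 - r ^ 2) ^ 2) (by fun_prop) (fun _ => by positivity)
  have fl := hee_flux s N L A hs hN hL κ hA hAq hAκ U D H cU cD cH dF hH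
  simp only [hUs, one_mul, map_one, mul_one, Complex.ofReal_one, Complex.ofReal_zero, zero_mul,
    mul_zero, intervalIntegral.integral_zero, sub_zero] at w1 m1
  simp only [sub_self, mul_zero, Complex.ofReal_zero, zero_mul, zero_sub, norm_neg, ne_eq,
    OfNat.ofNat_ne_zero, not_false_eq_true, zero_pow] at w2
  set q := N / s ^ 2 + L with hqdef
  have hq : 0 < q := by positivity
  have hK := norm_nonneg κ
  set K := ‖κ‖ with hKdef
  set E := ∫ r in (0:ℝ)..s, (heep N L r * ‖D r‖ ^ 2 + ‖H r‖ * ‖U r‖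
        + K * heep N L r * ‖U r‖ ^ 2) with hE
  set E2 := ∫ r in (0:ℝ)..s, (s ^ 2 - r ^ 2) ^ 2 * (heep N L r * ‖D r‖ ^ 2 + ‖H r‖ * ‖U r‖
        + K * heep N L r * ‖U r‖ ^ 2) with hE2
  set J := ∫ r in (0:ℝ)..s, ‖U r‖ ^ 2 * r with hJ
  set J2 := ∫ r in (0:ℝ)..s, (s ^ 2 - r ^ 2) ^ 2 * (‖U r‖ ^ 2 * r) with hJ2
  have hEle : E ≤ 25 * (A / (s * q)) := by linarith
  have hqK : 0 < q + K := by positivity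
  have hJle : J ≤ 75 * (s / A) := by
    have h1 : (q + K) * J ≤ 25 * (s * A) := by
      refine m1.trans ?_
      calc s ^ 2 * q * E ≤ s ^ 2 * q * (25 * (A / (s * q))) := by gcongr
        _ = _ := by field_simp
    have h2 : J ≤ 25 * (s * A) / (q + K) := by
      rw [le_div_iff₀ hqK]; linarith
    refine h2.trans ?_
    rw [mul_div_assoc', div_le_div_iff₀ hqK hA0]
    nlinarith [mul_le_mul_of_nonneg_left hA3 hs.le]
  refine ⟨hJle, ?_⟩
  have hcross : ‖∫ r in (0:ℝ)..s, (heep N L r : ℂ) * D r *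
      (((-4 * r * (s ^ 2 - r ^ 2) : ℝ) : ℂ) * (starRingEnd ℂ) (U r))‖ ≤
      1 / 5 * E2 + 20 / q * J := by
    have cC : Continuous (fun r : ℝ => ((-4 * r * (s ^ 2 - r ^ 2) : ℝ) : ℂ)) := by fun_prop
    have cC' := cC.continuousOn (s := Set.Icc 0 s)
    calc _ ≤ ∫ r in (0:ℝ)..s, ‖(heep N L r : ℂ) * D r *
      (((-4 * r * (s ^ 2 - r ^ 2) : ℝ) : ℂ) * (starRingEnd ℂ) (U r))‖ :=
          intervalIntegral.norm_integral_le_integral_norm hs.le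
      _ ≤ ∫ r in (0:ℝ)..s, (1 / 5 * ((s ^ 2 - r ^ 2) ^ 2 * (heep N L r * ‖D r‖ ^ 2
            + ‖H r‖ * ‖U r‖ + K * heep N L r * ‖U r‖ ^ 2)) + 20 / q * (‖U r‖ ^ 2 * r)) := by
        refine intervalIntegral.integral_mono_on_of_le_Ioo hs.le
          (ContinuousOn.intervalIntegrable_of_Icc hs.le (by fun_prop))
          (ContinuousOn.intervalIntegrable_of_Icc hs.le (by fun_prop)) (fun r hr => ?_)
        have hr0 : 0 < r := hr.1
        have hrs : r < s := hr.2
        have p0 : 0 ≤ heep N L r := by unfold heep; positivity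
        have ple := hee_p_le s N L r hs hN hL hr0 hrs
        rw [← hqdef] at ple
        have hw : 0 < s ^ 2 - r ^ 2 := by nlinarith
        have nw : ‖-4 * r * (s ^ 2 - r ^ 2)‖ = 4 * r * (s ^ 2 - r ^ 2) := by
          rw [norm_mul, norm_mul, Real.norm_of_nonneg hw.le, Real.norm_of_nonneg hr0.le]
          norm_num
        simp only [norm_mul, Complex.norm_real, Real.norm_of_nonneg p0, RCLike.norm_conj] at nw ⊢
        rw [nw]
        have pr : 20 * (heep N L r * r ^ 2 * ‖U r‖ ^ 2) ≤ 20 / q * (‖U r‖ ^ 2 * r) := by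
          calc _ ≤ 20 * (1 / (r * q) * r ^ 2 * ‖U r‖ ^ 2) := by gcongr
            _ = _ := by field_simp
        have sqr := mul_le_mul_of_nonneg_left
          (sq_nonneg ((s ^ 2 - r ^ 2) * ‖D r‖ - 10 * (r * ‖U r‖))) p0
        have r1 : 0 ≤ (s ^ 2 - r ^ 2) ^ 2 * (‖H r‖ * ‖U r‖ + K * heep N L r * ‖U r‖ ^ 2) := by
          positivity
        linarith
      _ = _ := by
        rw [intervalIntegral.integral_add, intervalIntegral.integral_const_mul,
          intervalIntegral.integral_const_mul]
        · exact ContinuousOn.intervalIntegrable_of_Icc hs.le (by fun_prop)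
        · exact ContinuousOn.intervalIntegrable_of_Icc hs.le (by fun_prop)
  have hE2le : E2 ≤ 100 / q * J := by
    have : 100 / q * J = 5 * (20 / q * J) := by ring
    linarith
  have hE2le' : E2 ≤ 7500 * (s / (A * q)) := by
    refine hE2le.trans ?_
    calc _ ≤ 100 / q * (75 * (s / A)) := by gcongr
      _ = _ := by field_simp; norm_num
  have h1 : (q + K) * J2 ≤ 7500 * (s ^ 3 / A) := by
    refine m2.trans ?_
    calc s ^ 2 * q * E2 ≤ s ^ 2 * q * (7500 * (s / (A * q))) := by gcongr
      _ = _ := by field_simp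
  have h2 : J2 ≤ 7500 * (s ^ 3 / A) / (q + K) := by
    rw [le_div_iff₀ hqK]; linarith
  refine h2.trans ?_
  rw [div_le_iff₀ hqK]
  have : 7500 * (s ^ 3 / A) = 7500 * (s / A) ^ 3 * A ^ 2 := by field_simp
  rw [this]
  have h3 : 0 ≤ 7500 * (s / A) ^ 3 := by positivity
  nlinarith [mul_le_mul_of_nonneg_left hA3 h3]

set_option maxHeartbeats 2000000

/-- Estimates for the homogeneous elliptic problem on `(0,s)` (Proposition 5.4). -/
theorem homogeneous_elliptic_estimates_on_subinterval :
    ∃ C : ℝ, 0 < C ∧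
      ∀ (n l : ℤ), n ≠ 0 → l ≠ 0 → ∀ ν : ℝ, 0 < ν →
        ∀ s ∈ Set.Ioc (0:ℝ) 1, ∀ lamt : ℂ,
          ∀ A₁s : ℝ,
            A₁s = ‖(l : ℂ) * (lamt - (s : ℂ) ^ 2) / (ν : ℂ)‖ ^ ((1:ℝ)/2)
                    + |(l : ℝ)| + |(n : ℝ) / s| →
            (l : ℝ) * lamt.im
                ≤ max (‖(l : ℂ) * (lamt - (s : ℂ) ^ 2)‖ / 2)
                    (ν * ((n : ℝ) ^ 2 / s ^ 2 + (l : ℝ) ^ 2) / 3) →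
            1 ≤ |ν / (s * (l : ℝ))| ^ ((1:ℝ)/3) * A₁s →
            ∀ U : ℝ → ℂ,
              ContDiffOn ℝ (⊤ : ℕ∞) U (Set.Icc 0 s) →
              (∀ r ∈ Set.Ioo (0:ℝ) s,
                -(ν : ℂ) * hatD1 n l U r
                  + Complex.I * (l : ℂ) * (lamt - (s : ℂ) ^ 2) * U r = 0) →
              U 0 = 0 → U s = 1 →
              (∫ r in Set.Ioo (0:ℝ) s, ‖U r‖ ^ 2 * r) ≤ C * (A₁s / s)⁻¹ ∧
              (∫ r in Set.Ioo (0:ℝ) s, ‖((s : ℂ) ^ 2 - (r : ℂ) ^ 2) * U r‖ ^ 2 * r)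
                ≤ C * (A₁s / s) ^ (-(3:ℝ)) := by
  refine ⟨22500, by norm_num, ?_⟩
  intro n l hn hl ν hν s hs lamt A hA hIm _ U hU hode hU0 hUs
  obtain ⟨hs0, hs1⟩ := hs
  obtain ⟨κ, hκd⟩ : ∃ κ : ℂ, κ = Complex.I * (l : ℂ) * (lamt - (s : ℂ) ^ 2) / (ν : ℂ) := ⟨_, rfl⟩
  have hνC : (ν : ℂ) ≠ 0 := by exact_mod_cast hν.ne'
  have hn2 : (1:ℝ) ≤ (n : ℝ) ^ 2 := by
    have : (1:ℤ) ≤ n ^ 2 := by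
      have := sq_pos_of_ne_zero hn
      omega
    exact_mod_cast this
  have hl2 : (0:ℝ) ≤ (l : ℝ) ^ 2 := by positivity
  have hnorm : ‖(l : ℂ) * (lamt - (s : ℂ) ^ 2) / (ν : ℂ)‖ = ‖κ‖ := by
    rw [hκd]; simp
  have hnorm2 : ‖(l : ℂ) * (lamt - (s : ℂ) ^ 2)‖ = ν * ‖κ‖ := by
    rw [← hnorm, norm_div, Complex.norm_real, Real.norm_of_nonneg hν.le]
    field_simp
  have hre : κ.re = -((l : ℝ) * lamt.im / ν) := by
    have e : κ = Complex.I * ((l : ℝ) * (lamt - ((s ^ 2 : ℝ) : ℂ))) / ((ν : ℝ) : ℂ) := by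
      rw [hκd]; push_cast; ring
    rw [e, Complex.div_ofReal_re, Complex.I_mul_re]
    simp [← Complex.ofReal_pow]
    ring
  rw [hnorm] at hA
  set a := ‖κ‖ ^ ((1:ℝ) / 2) with ha
  have ha0 : 0 ≤ a := by positivity
  have ha2 : a ^ 2 = ‖κ‖ := by
    rw [ha, ← Real.sqrt_eq_rpow, Real.sq_sqrt (norm_nonneg _)]
  have hns : |(n : ℝ) / s| = |(n : ℝ)| / s := by rw [abs_div, abs_of_pos hs0]
  set y := |(n : ℝ) / s| with hy
  have hy0 : 0 ≤ y := abs_nonneg _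
  have hy2 : y ^ 2 = (n : ℝ) ^ 2 / s ^ 2 := by rw [hy, sq_abs, div_pow]
  set x := |(l : ℝ)| with hx
  have hx0 : 0 ≤ x := abs_nonneg _
  have hx2 : x ^ 2 = (l : ℝ) ^ 2 := by rw [hx, sq_abs]
  have hys : 1 ≤ y * s := by
    rw [hns, div_mul_cancel₀ _ hs0.ne']
    have : (1:ℤ) ≤ |n| := Int.one_le_abs hn
    exact_mod_cast this
  have hκ : -κ.re ≤ max (‖κ‖ / 2) (((n : ℝ) ^ 2 / s ^ 2 + (l : ℝ) ^ 2) / 3) := by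
    rw [hre, neg_neg, div_le_iff₀ hν]
    rw [hnorm2] at hIm
    rcases le_max_iff.1 hIm with h | h
    · have := mul_le_mul_of_nonneg_right
        (le_max_left (‖κ‖ / 2) (((n : ℝ) ^ 2 / s ^ 2 + (l : ℝ) ^ 2) / 3)) hν.le
      linarith
    · have := mul_le_mul_of_nonneg_right
        (le_max_right (‖κ‖ / 2) (((n : ℝ) ^ 2 / s ^ 2 + (l : ℝ) ^ 2) / 3)) hν.le
      linarith
  have hAs : 1 ≤ A * s := by
    rw [hA]; nlinarith [mul_nonneg ha0 hs0.le, mul_nonneg hx0 hs0.le]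
  have hA0 : 0 < A := by
    by_contra h
    push Not at h
    nlinarith
  have hxy := mul_nonneg hx0 hy0
  have hax := mul_nonneg ha0 hx0
  have hay := mul_nonneg ha0 hy0
  have hud : UniqueDiffOn ℝ (Set.Icc 0 s) := uniqueDiffOn_Icc hs0
  have hD : ContDiffOn ℝ (⊤ : ℕ∞) (derivWithin U (Set.Icc 0 s)) (Set.Icc 0 s) :=
    hU.derivWithin hud (by simp)
  have hD2 : ContDiffOn ℝ (⊤ : ℕ∞)
      (derivWithin (derivWithin U (Set.Icc 0 s)) (Set.Icc 0 s)) (Set.Icc 0 s) :=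
    hD.derivWithin hud (by simp)
  have dU : ∀ r ∈ Set.Ioo 0 s, HasDerivAt U (derivWithin U (Set.Icc 0 s) r) r := fun r hr =>
    ((hU.differentiableOn (by simp)) r (Set.Ioo_subset_Icc_self hr)).hasDerivWithinAt.hasDerivAt
      (Icc_mem_nhds hr.1 hr.2)
  have dD : ∀ r ∈ Set.Ioo 0 s, HasDerivAt (derivWithin U (Set.Icc 0 s))
      (derivWithin (derivWithin U (Set.Icc 0 s)) (Set.Icc 0 s) r) r := fun r hr =>
    ((hD.differentiableOn (by simp)) r (Set.Ioo_subset_Icc_self hr)).hasDerivWithinAt.hasDerivAt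
      (Icc_mem_nhds hr.1 hr.2)
  have e1 : ∀ r ∈ Set.Ioo 0 s, deriv U r = derivWithin U (Set.Icc 0 s) r :=
    fun r hr => (dU r hr).deriv
  have e2 : ∀ r ∈ Set.Ioo 0 s, deriv (deriv U) r =
      derivWithin (derivWithin U (Set.Icc 0 s)) (Set.Icc 0 s) r := fun r hr => by
    rw [← (dD r hr).deriv]
    apply Filter.EventuallyEq.deriv_eq
    filter_upwards [Ioo_mem_nhds hr.1 hr.2] with t ht
    exact e1 t ht
  have cU := hU.continuousOn
  have cD := hD.continuousOn
  have cD2 := hD2.continuousOn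
  generalize derivWithin (derivWithin U (Set.Icc 0 s)) (Set.Icc 0 s) = D2 at *
  generalize derivWithin U (Set.Icc 0 s) = D at *
  set N := (n : ℝ) ^ 2 with hNd
  set L := (l : ℝ) ^ 2 with hLd
  have cp := heep_cont N L hn2 hl2
  have cpC : ContinuousOn (fun r => (heep N L r : ℂ)) (Set.Icc 0 s) :=
    (Complex.continuous_ofReal.comp cp).continuousOn
  set p' : ℝ → ℝ := fun r => (N - r ^ 2 * L) / (N + r ^ 2 * L) ^ 2 with hp'
  have cp' : Continuous p' := by
    refine Continuous.div (by fun_prop) (by fun_prop) (fun r => ?_)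
    positivity
  have cpC' : ContinuousOn (fun r => (p' r : ℂ)) (Set.Icc 0 s) :=
    (Complex.continuous_ofReal.comp cp').continuousOn
  have dp : ∀ r, HasDerivAt (heep N L) (p' r) r := fun r => by
    have h1 : HasDerivAt (fun r : ℝ => N + r ^ 2 * L) (2 * r * L) r := by
      have := ((hasDerivAt_pow 2 r).mul_const L).const_add N
      simpa using this
    have h2 := (hasDerivAt_id r).div h1 (by positivity)
    refine HasDerivAt.congr_deriv h2 ?_
    simp only [hp', id]
    ring
  have main := hee_core s N L A hs0 hn2 hl2 κ hκ hAs (by rw [hA, ← hy2, ← hx2]; nlinarith)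
    (by rw [hA, ← ha2]; nlinarith)
    (by
      rw [hA, ← ha2, ← hy2, ← hx2]
      nlinarith [sq_nonneg (a - x), sq_nonneg (a - y), sq_nonneg (x - y)])
    U D (fun r => (p' r * D r + heep N L r * D2 r) - κ * heep N L r * U r) cU cD
    (by fun_prop) dU
    (fun r hr => by
      refine HasDerivAt.congr_deriv ((dp r).ofReal_comp.mul (dD r hr)) ?_
      ring)
    (fun r hr => by
      have h := hode r hr
      have hr0 : (0:ℝ) < r := hr.1
      have hrC : (r : ℂ) ≠ 0 := by exact_mod_cast hr0.ne'
      have hQ : ((n:ℂ) ^ 2 + (r : ℂ) ^ 2 * (l : ℂ) ^ 2) ≠ 0 := by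
        have : N + r ^ 2 * L ≠ 0 := by positivity
        rw [hNd, hLd] at this
        exact_mod_cast this
      unfold hatD1 at h
      rw [e1 r hr, e2 r hr] at h
      have h' : D2 r + D r / (r : ℂ)
          - ((n : ℂ) ^ 2 / (r : ℂ) ^ 2 + (l : ℂ) ^ 2) * U r
          - (2 * (r : ℂ) * (l : ℂ) ^ 2 / ((n : ℂ) ^ 2 + (r : ℂ) ^ 2 * (l : ℂ) ^ 2)) * D r
          = κ * U r := by
        have hk : κ * (ν : ℂ) = Complex.I * (l : ℂ) * (lamt - (s : ℂ) ^ 2) := by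
          rw [hκd, div_mul_cancel₀ _ hνC]
        rw [← hk] at h
        apply mul_left_cancel₀ hνC
        linear_combination -h
      have h3 : D2 r = κ * U r - D r / (r : ℂ)
          + ((n : ℂ) ^ 2 / (r : ℂ) ^ 2 + (l : ℂ) ^ 2) * U r
          + (2 * (r : ℂ) * (l : ℂ) ^ 2 / ((n : ℂ) ^ 2 + (r : ℂ) ^ 2 * (l : ℂ) ^ 2)) * D r := by
        linear_combination h'
      simp only [h3, hp', heep, hNd, hLd]
      push_cast
      field_simp
      ring) hUs
  have hinv : (A / s)⁻¹ = s / A := inv_div _ _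
  have hr3 : (A / s) ^ (-(3:ℝ)) = (s / A) ^ 3 := by
    have h3 : (A / s) ^ (3:ℝ) = (A / s) ^ 3 := by
      exact_mod_cast Real.rpow_natCast (A / s) 3
    rw [Real.rpow_neg (by positivity), h3, ← inv_pow, inv_div]
  have hsA : 0 ≤ s / A := by positivity
  rw [hinv, hr3, ← integral_Ioc_eq_integral_Ioo, ← integral_Ioc_eq_integral_Ioo,
    ← intervalIntegral.integral_of_le hs0.le, ← intervalIntegral.integral_of_le hs0.le]
  refine ⟨main.1.trans (by nlinarith), ?_⟩
  refine le_trans (le_of_eq ?_) main.2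
  congr 1
  ext r
  have : ((s : ℂ) ^ 2 - (r : ℂ) ^ 2) = ((s ^ 2 - r ^ 2 : ℝ) : ℂ) := by push_cast; ring
  rw [this, norm_mul, Complex.norm_real, mul_pow, Real.norm_eq_abs, sq_abs]
  ring
end
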